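/- arXiv:1912.04600 — 2 statements merged into one kernel-verified Lean document; each statement's English description precedes it below -/
import Mathlib

section
/- The equation (X³ + 7Y³)(X² + 4XY + 16Y²)(16X² + 4XY + Y²) = 262193⁴ · Z⁷ defines a non-singular plane projective curve of degree 7, has solutions other than (0,0,0) over ℝ and over ℚ_l for every prime l, but has no solution in rational numbers other than (0,0,0); that is, it violates the local-global principle. -/
open MvPolynomial

/-- The equation `(X³+aY³) ∏_j (b_j²X² + b_j c_j XY + c_j² Y²) = L Z^n`, evaluated
in a commutative ring `K`; here `bc j = (b_j, c_j)`. -/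
def EqnHolds {K : Type} [CommRing K] (a L : ℤ) (n : ℕ) {m : ℕ} (bc : Fin m → ℤ × ℤ)
    (X Y Z : K) : Prop :=
  (X ^ 3 + (a : K) * Y ^ 3) *
      ∏ j : Fin m, (((bc j).1 : K) ^ 2 * X ^ 2 + ((bc j).1 : K) * ((bc j).2 : K) * X * Y
        + ((bc j).2 : K) ^ 2 * Y ^ 2)
    = (L : K) * Z ^ n

/-- The homogeneous equation `(X³+aY³) ∏_j (b_j²X² + b_j c_j XY + c_j² Y²) = L Z^n`
violates the local-global principle: it has nontrivial solutions over `ℝ` and over `ℚ_l`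
for every prime `l`, but only the trivial solution over `ℚ`. -/
def ViolatesLGP (a L : ℤ) (n : ℕ) {m : ℕ} (bc : Fin m → ℤ × ℤ) : Prop :=
  (∃ X Y Z : ℝ, (X, Y, Z) ≠ (0, 0, 0) ∧ EqnHolds a L n bc X Y Z) ∧
  (∀ (l : ℕ) [Fact l.Prime], ∃ X Y Z : ℚ_[l], (X, Y, Z) ≠ (0, 0, 0) ∧ EqnHolds a L n bc X Y Z) ∧
  (∀ X Y Z : ℚ, EqnHolds a L n bc X Y Z → (X, Y, Z) = (0, 0, 0))

/-- The homogeneous polynomial `(X³+aY³) ∏_j (b_j²X² + b_j c_j XY + c_j² Y²) - L Z^n`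
over `ℂ`. -/
noncomputable def curvePoly (a L : ℤ) (n : ℕ) {m : ℕ} (bc : Fin m → ℤ × ℤ) :
    MvPolynomial (Fin 3) ℂ :=
  (X 0 ^ 3 + C (a : ℂ) * X 1 ^ 3) *
      ∏ j : Fin m, (C (((bc j).1 : ℂ)) ^ 2 * X 0 ^ 2
        + C (((bc j).1 : ℂ)) * C (((bc j).2 : ℂ)) * X 0 * X 1
        + C (((bc j).2 : ℂ)) ^ 2 * X 1 ^ 2)
    - C (L : ℂ) * X 2 ^ n

/-- A homogeneous polynomial `F` defines a non-singular plane projective curve: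
`F` and its partial derivatives have no common zero other than the origin over `ℂ`. -/
def IsNonsingular (F : MvPolynomial (Fin 3) ℂ) : Prop :=
  ∀ v : Fin 3 → ℂ, v ≠ 0 →
    ¬ (eval v F = 0 ∧ ∀ i : Fin 3, eval v (pderiv i F) = 0)

theorem eqnHolds_degree_seven_iff {K : Type} [CommRing K] (X Y Z : K) :
    EqnHolds 7 (262193 ^ 4) 7 ![(1, 4), (4, 1)] X Y Z ↔
      (X ^ 3 + 7 * Y ^ 3) * ((X ^ 2 + 4 * X * Y + 16 * Y ^ 2) *
        (16 * X ^ 2 + 4 * X * Y + Y ^ 2)) = 262193 ^ 4 * Z ^ 7 := by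
  simp only [EqnHolds, Fin.prod_univ_two, Matrix.cons_val_zero, Matrix.cons_val_one]
  push_cast
  constructor <;> intro h <;> linear_combination h

theorem curvePoly_degree_seven_eq :
    curvePoly 7 (262193 ^ 4) 7 ![(1, 4), (4, 1)] =
      (X 0 ^ 3 + C 7 * X 1 ^ 3) * ((X 0 ^ 2 + C 4 * X 0 * X 1 + C 16 * X 1 ^ 2) *
        (C 16 * X 0 ^ 2 + C 4 * X 0 * X 1 + X 1 ^ 2)) - C (262193 ^ 4) * X 2 ^ 7 := by
  simp only [curvePoly, Fin.prod_univ_two, Matrix.cons_val_zero, Matrix.cons_val_one]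
  simp only [Int.cast_one, Int.cast_ofNat, Int.cast_pow, C_1]
  have h : (C 16 : MvPolynomial (Fin 3) ℂ) = C 4 ^ 2 := by rw [← C_pow]; norm_num
  rw [h]
  ring

theorem curvePoly_degree_seven_totalDegree :
    (curvePoly 7 (262193 ^ 4) 7 ![(1, 4), (4, 1)]).totalDegree = 7 := by
  rw [curvePoly_degree_seven_eq]
  refine IsHomogeneous.totalDegree ?_ ?_
  · have hX (i : Fin 3) (n : ℕ) : (X i ^ n : MvPolynomial (Fin 3) ℂ).IsHomogeneous n :=
      isHomogeneous_X_pow i n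
    have hC (c : ℂ) {p : MvPolynomial (Fin 3) ℂ} {n : ℕ} (hp : p.IsHomogeneous n) :
        (C c * p).IsHomogeneous n := hp.C_mul c
    have hXY (c : ℂ) : (C c * X 0 * X 1 : MvPolynomial (Fin 3) ℂ).IsHomogeneous 2 :=
      (hC c (isHomogeneous_X ℂ 0)).mul (isHomogeneous_X ℂ 1)
    exact (((hX 0 3).add (hC _ (hX 1 3))).mul ((((hX 0 2).add (hXY _)).add (hC _ (hX 1 2))).mul
      (((hC _ (hX 0 2)).add (hXY _)).add (hX 1 2)))).sub (hC _ (hX 2 7))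
  · intro h
    have := congrArg (eval ![(1 : ℂ), 0, 0]) h
    simp [map_ofNat] at this

theorem curvePoly_degree_seven_isNonsingular :
    IsNonsingular (curvePoly 7 (262193 ^ 4) 7 ![(1, 4), (4, 1)]) := by
  rw [curvePoly_degree_seven_eq]
  rintro v hv ⟨h0, h⟩
  have hX := h 0
  have hY := h 1
  have hZ := h 2
  clear h
  simp [Derivation.leibniz_pow, pderiv_X] at hX hY hZ h0
  have hv0 : v 0 = 0 → v 1 = 0 → False := fun h h' => hv (by
    ext i; fin_cases i <;> assumption)
  generalize v 0 = x at *
  generalize v 1 = y at *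
  rw [hZ] at h0
  have hy : y ≠ 0 := by
    rintro rfl
    simp at h0
    exact hv0 h0 rfl
  have h0' : (x ^ 3 + 7 * y ^ 3) * ((x ^ 2 + 4 * x * y + 16 * y ^ 2) *
      (16 * x ^ 2 + 4 * x * y + y ^ 2)) = 0 := by linear_combination h0
  clear h0 hv hv0 hZ
  have hy' (n : ℕ) : y ^ n ≠ 0 := pow_ne_zero n hy
  rcases mul_eq_zero.1 h0' with hA | h
  · rw [hA] at hX
    have hx : x ≠ 0 := by
      rintro rfl
      apply hy' 3
      linear_combination hA / 7
    have : (x ^ 2 + 4 * x * y + 16 * y ^ 2) * (16 * x ^ 2 + 4 * x * y + y ^ 2) = 0 := by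
      have : x ^ 2 ≠ 0 := pow_ne_zero 2 hx
      apply mul_right_cancel₀ this
      linear_combination hX / 3
    rcases mul_eq_zero.1 this with h | h
    · apply hy' 3
      linear_combination (hA - (x - 4 * y) * h) / 71
    · apply hy' 3
      linear_combination (64 * hA - (4 * x - y) * h) / 449
  · rcases mul_eq_zero.1 h with hB | hC
    · rw [hB] at hX
      have : (x ^ 3 + 7 * y ^ 3) * ((16 * x ^ 2 + 4 * x * y + y ^ 2) * (2 * x + 4 * y)) = 0 := by
        linear_combination hX
      rcases mul_eq_zero.1 this with h | h
      · apply hy' 3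
        linear_combination (h - (x - 4 * y) * hB) / 71
      rcases mul_eq_zero.1 h with h | h
      · have : 4 * x + 17 * y = 0 := by
          apply mul_right_cancel₀ hy
          linear_combination (16 * hB - h) / 15
        apply hy' 2
        linear_combination (16 * hB - (4 * x - y) * this) / 273
      · apply hy' 2
        linear_combination (hB - (x / 2 + y) * h) / 12
    · rw [hC] at hX
      have : (x ^ 3 + 7 * y ^ 3) * ((x ^ 2 + 4 * x * y + 16 * y ^ 2) * (32 * x + 4 * y)) = 0 := by
        linear_combination hX
      rcases mul_eq_zero.1 this with h | h
      · apply hy' 3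
        linear_combination (64 * h - (4 * x - y) * hC) / 449
      rcases mul_eq_zero.1 h with h | h
      · have : 4 * x + 17 * y = 0 := by
          apply mul_right_cancel₀ hy
          linear_combination (16 * h - hC) / 15
        apply hy' 2
        linear_combination (16 * h - (4 * x - y) * this) / 273
      · apply hy' 2
        linear_combination (hC - (x / 2 + y / 16) * h) * 4 / 3

theorem exists_real_solution : ∃ X Y Z : ℝ, (X, Y, Z) ≠ (0, 0, 0) ∧
    EqnHolds 7 (262193 ^ 4) 7 ![(1, 4), (4, 1)] X Y Z := by
  refine ⟨1, 0, (16 / 262193 ^ 4) ^ (1 / 7 : ℝ), by simp, ?_⟩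
  have h : ((16 / 262193 ^ 4 : ℝ) ^ (1 / 7 : ℝ)) ^ 7 = 16 / 262193 ^ 4 := by
    rw [← Real.rpow_natCast, ← Real.rpow_mul (by positivity)]
    norm_num
  rw [eqnHolds_degree_seven_iff, h]
  norm_num

theorem Padic.exists_aeval_eq_zero {p : ℕ} [Fact p.Prime] (F : Polynomial ℤ) (a : ℤ)
    (h : ((F.eval a : ℤ) : ZMod p) = 0) (h' : ((F.derivative.eval a : ℤ) : ZMod p) ≠ 0) :
    ∃ z : ℚ_[p], Polynomial.aeval z F = 0 := by
  have key (G : Polynomial ℤ) : Polynomial.aeval (a : ℤ_[p]) G = (G.eval a : ℤ) := by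
    have := Polynomial.aeval_algebraMap_apply_eq_algebraMap_eval (A := ℤ_[p]) a G
    simpa using this
  obtain ⟨z, hz, -⟩ := hensels_lemma (p := p) (F := F) (a := (a : ℤ_[p])) (by
    rw [key, key]
    rw [ZMod.intCast_zmod_eq_zero_iff_dvd] at h
    rw [Ne, ZMod.intCast_zmod_eq_zero_iff_dvd] at h'
    have h1 := (PadicInt.norm_int_lt_one_iff_dvd (p := p) _).2 h
    have h2 : ‖((F.derivative.eval a : ℤ) : ℤ_[p])‖ = 1 := by
      refine le_antisymm (PadicInt.norm_le_one _) (not_lt.1 fun h3 => h' ?_)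
      exact (PadicInt.norm_int_lt_one_iff_dvd _).1 h3
    rw [h2]; simpa using h1)
  refine ⟨z, ?_⟩
  have := Polynomial.aeval_algebraMap_apply ℚ_[p] z F
  rwa [hz, map_zero] at this

theorem exists_padic_solution (l : ℕ) [Fact l.Prime] : ∃ X Y Z : ℚ_[l], (X, Y, Z) ≠ (0, 0, 0) ∧
    EqnHolds 7 (262193 ^ 4) 7 ![(1, 4), (4, 1)] X Y Z := by
  have hl : l.Prime := Fact.out
  simp only [eqnHolds_degree_seven_iff]
  have h3 : l % 3 = 0 ∨ l % 3 = 1 ∨ l % 3 = 2 := by omega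
  rcases h3 with h3 | h3 | h3
  · obtain rfl : l = 3 := ((Nat.prime_dvd_prime_iff_eq Nat.prime_three hl).1
      (Nat.dvd_of_mod_eq_zero h3)).symm
    obtain ⟨z, hz⟩ := Padic.exists_aeval_eq_zero (p := 3)
      (Polynomial.C (262193 ^ 4) * Polynomial.X ^ 7 - Polynomial.C 16) 1
      (by rw [ZMod.intCast_zmod_eq_zero_iff_dvd]; norm_num)
      (by rw [Ne, ZMod.intCast_zmod_eq_zero_iff_dvd]; norm_num)
    refine ⟨1, 0, z, by simp, ?_⟩
    simp [map_ofNat (Polynomial.aeval z)] at hz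
    linear_combination -hz
  · obtain ⟨w, hw⟩ : ∃ w : ZMod l, w ^ 2 + w + 1 = 0 := by
      obtain ⟨u, hu⟩ := exists_prime_orderOf_dvd_card (G := (ZMod l)ˣ) 3 (by
        rw [ZMod.card_units]; exact (Nat.modEq_iff_dvd' hl.one_le).1 h3.symm)
      have h1 : (u : ZMod l) ≠ 1 := by
        intro h
        rw [Units.val_eq_one] at h
        simp [h] at hu
      have h2 : (u : ZMod l) ^ 3 = 1 := by
        rw [← Units.val_pow_eq_pow_val, ← hu, pow_orderOf_eq_one, Units.val_one]
      refine ⟨u, mul_left_cancel₀ (sub_ne_zero.2 h1) ?_⟩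
      linear_combination h2
    have h3' : (3 : ZMod l) ≠ 0 := by
      intro h
      have : l ∣ 3 := (ZMod.natCast_eq_zero_iff 3 l).1 (by exact_mod_cast h)
      rw [Nat.prime_dvd_prime_iff_eq hl Nat.prime_three] at this
      omega
    obtain ⟨a, rfl⟩ := ZMod.intCast_surjective w
    obtain ⟨z, hz⟩ := Padic.exists_aeval_eq_zero (p := l)
      (Polynomial.X ^ 2 + Polynomial.X + 1) a (by simpa using hw) (by
        simp
        intro h
        apply h3'
        linear_combination 4 * hw - (2 * (a : ZMod l) + 1) * h)
    refine ⟨4 * z, 1, 0, by simp, ?_⟩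
    simp at hz
    linear_combination ((4 * z) ^ 3 + 7) * (16 * (4 * z) ^ 2 + 16 * z + 1)
      * 16 * hz
  · have h7 : (7 : ZMod l) ≠ 0 := by
      intro h
      have : l ∣ 7 := (ZMod.natCast_eq_zero_iff 7 l).1 (by exact_mod_cast h)
      rw [Nat.prime_dvd_prime_iff_eq hl (by norm_num)] at this
      omega
    have h3' : (3 : ZMod l) ≠ 0 := by
      intro h
      have : l ∣ 3 := (ZMod.natCast_eq_zero_iff 3 l).1 (by exact_mod_cast h)
      rw [Nat.prime_dvd_prime_iff_eq hl Nat.prime_three] at this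
      omega
    obtain ⟨s, hs⟩ : ∃ s : ZMod l, s ^ 3 = 7 := by
      refine ⟨7 ^ (2 * (l / 3) + 1), ?_⟩
      have h := ZMod.pow_card_sub_one_eq_one h7
      rw [← pow_mul, show (2 * (l / 3) + 1) * 3 = (l - 1) * 2 + 1 by omega, pow_succ, pow_mul, h]
      simp
    obtain ⟨a, rfl⟩ := ZMod.intCast_surjective s
    obtain ⟨z, hz⟩ := Padic.exists_aeval_eq_zero (p := l)
      (Polynomial.X ^ 3 - Polynomial.C 7) a (by simp [hs]) (by
        simp
        refine ⟨h3', fun h => h7 ?_⟩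
        rw [← hs, h]; simp)
    refine ⟨z, -1, 0, by simp, ?_⟩
    simp [map_ofNat (Polynomial.aeval z)] at hz
    linear_combination (16 - 4 * z + z ^ 2) * (16 * z ^ 2 - 4 * z + 1) * hz

theorem Int.dvd_of_dvd_sq_add_mul_add_sq {p : ℕ} (hp : p.Prime) (hp3 : p % 3 = 2) {a b : ℤ}
    (h : (p : ℤ) ∣ a ^ 2 + a * b + b ^ 2) : (p : ℤ) ∣ a ∧ (p : ℤ) ∣ b := by
  have : Fact p.Prime := ⟨hp⟩
  rw [← ZMod.intCast_zmod_eq_zero_iff_dvd] at h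
  simp only [← ZMod.intCast_zmod_eq_zero_iff_dvd]
  push_cast at h
  generalize (a : ZMod p) = a at *
  generalize (b : ZMod p) = b at *
  have hpow (z : ZMod p) : (z ^ 3) ^ (2 * (p / 3) + 1) = z := by
    rw [← pow_mul, show 3 * (2 * (p / 3) + 1) = p + (p - 1) by omega, pow_add, ZMod.pow_card,
      ← pow_succ', Nat.sub_add_cancel hp.one_le, ZMod.pow_card]
  have hab : a = b := by
    rw [← hpow a, ← hpow b, show a ^ 3 = b ^ 3 by linear_combination (a - b) * h]
  subst hab
  have h3 : (3 : ZMod p) ≠ 0 := by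
    intro h3
    have : p ∣ 3 := (ZMod.natCast_eq_zero_iff 3 p).1 (by exact_mod_cast h3)
    rw [Nat.prime_dvd_prime_iff_eq hp Nat.prime_three] at this
    omega
  have : a = 0 := by
    refine pow_eq_zero_iff two_ne_zero |>.1 ((mul_eq_zero.1 ?_).resolve_left h3)
    linear_combination h
  exact ⟨this, this⟩

theorem prime_262193 : Nat.Prime 262193 := by norm_num

theorem not_seven_dvd_of_pow_three_add_eq {x y w P : ℤ} (hxy : IsCoprime x y) (hP7 : ¬ 7 ∣ P)
    (h : x ^ 3 + 7 * y ^ 3 = P ^ 4 * w ^ 7) : ¬ 7 ∣ x := by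
  have p7 : Prime (7 : ℤ) := by norm_num
  rintro ⟨x', rfl⟩
  have hw : 7 ∣ w := by
    refine p7.dvd_of_dvd_pow (n := 7) ((p7.dvd_or_dvd (a := P ^ 4) ?_).resolve_left
      (fun h => hP7 (p7.dvd_of_dvd_pow h)))
    exact ⟨49 * x' ^ 3 + y ^ 3, by rw [← h]; ring⟩
  obtain ⟨w', rfl⟩ := hw
  have hy : 7 ∣ y := p7.dvd_of_dvd_pow (n := 3)
    ⟨P ^ 4 * 7 ^ 5 * w' ^ 7 - 7 * x' ^ 3, by linarith⟩
  exact p7.not_isUnit (hxy.isUnit_of_dvd' ⟨x', rfl⟩ hy)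

theorem not_three_dvd_of_pow_three_add_eq {x y w P : ℤ} (hxy : IsCoprime x y) (hP3 : ¬ 3 ∣ P)
    (h : x ^ 3 + 7 * y ^ 3 = P ^ 4 * w ^ 7) : ¬ 3 ∣ x ^ 3 + 7 * y ^ 3 := by
  have p3 : Prime (3 : ℤ) := by norm_num
  intro h3A
  rw [h] at h3A
  obtain ⟨w', rfl⟩ := p3.dvd_of_dvd_pow ((p3.dvd_or_dvd h3A).resolve_left
    (fun h => hP3 (p3.dvd_of_dvd_pow h)))
  have h9 : ((x ^ 3 + 7 * y ^ 3 : ℤ) : ZMod 9) = 0 :=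
    (ZMod.intCast_zmod_eq_zero_iff_dvd _ 9).2 ⟨P ^ 4 * 3 ^ 5 * w' ^ 7, by
      rw [h]; push_cast; ring⟩
  have key : ∀ a b : ZMod 9, a ^ 3 + 7 * b ^ 3 = 0 → 3 * a = 0 ∧ 3 * b = 0 := by decide
  push_cast at h9
  obtain ⟨ha, hb⟩ := key _ _ h9
  have dvd (z : ℤ) (hz : 3 * (z : ZMod 9) = 0) : 3 ∣ z := by
    have : ((9 : ℕ) : ℤ) ∣ 3 * z :=
      (ZMod.intCast_zmod_eq_zero_iff_dvd _ 9).1 (by push_cast; exact hz)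
    omega
  exact p3.not_isUnit (hxy.isUnit_of_dvd' (dvd x ha) (dvd y hb))

theorem isCoprime_pow_three_add_seven {x y : ℤ} (h7x : ¬ 7 ∣ x) :
    IsCoprime (x ^ 3 + 7 * y ^ 3) 7 := by
  have p7 : Prime (7 : ℤ) := by norm_num
  rw [isCoprime_comm, p7.coprime_iff_not_dvd, dvd_add_left ⟨y ^ 3, rfl⟩]
  exact fun h => h7x (p7.dvd_of_dvd_pow h)

theorem isCoprime_pow_three_add_mul {x y : ℤ} (hxy : IsCoprime x y) (h7x : ¬ 7 ∣ x)
    (h3A : ¬ 3 ∣ x ^ 3 + 7 * y ^ 3) : IsCoprime (x ^ 3 + 7 * y ^ 3) (3 * x * y) := by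
  have p7 : Prime (7 : ℤ) := by norm_num
  have p3 : Prime (3 : ℤ) := by norm_num
  refine ((p3.coprime_iff_not_dvd.2 h3A).symm.mul_right ?_).mul_right ?_
  · rw [show x ^ 3 + 7 * y ^ 3 = 7 * y ^ 3 + x * x ^ 2 by ring,
      IsCoprime.add_mul_left_left_iff]
    exact ((p7.coprime_iff_not_dvd.2 h7x).mul_left hxy.symm.pow_left)
  · rw [show x ^ 3 + 7 * y ^ 3 = x ^ 3 + y * (7 * y ^ 2) by ring,
      IsCoprime.add_mul_left_left_iff]
    exact hxy.pow_left

theorem isCoprime_of_isCoprime_of_eq {x y P : ℤ} (hxy : IsCoprime x y) (hP : P = 262193) :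
    IsCoprime (64 * x ^ 2 + 7 * x * y - 4096 * y ^ 2) P := by
  have hprime : Prime P := by
    rw [hP]
    exact_mod_cast Nat.prime_iff_prime_int.1 prime_262193
  rw [isCoprime_comm, hprime.coprime_iff_not_dvd]
  rintro ⟨c, hc⟩
  obtain ⟨h1, h2⟩ := Int.dvd_of_dvd_sq_add_mul_add_sq prime_262193 (by norm_num)
    (a := 64 * x) (b := 7 * y) ⟨64 * c + y ^ 2, by
      push_cast
      rw [hP] at hc
      linear_combination 64 * hc⟩
  push_cast at h1 h2
  rw [← hP] at h1 h2
  exact hprime.not_isUnit (hxy.isUnit_of_dvd'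
    ((hprime.dvd_or_dvd h1).resolve_left (by rw [hP]; norm_num))
    ((hprime.dvd_or_dvd h2).resolve_left (by rw [hP]; norm_num)))

open NumberField

section PureCubic

variable {K : Type*} [Field K] [NumberField K]

theorem norm_intCast_sub_of_minpoly {F : Polynomial ℤ} {θ : 𝓞 K} (pb : PowerBasis ℚ K)
    (hθ : (θ : K) = pb.gen) (hF : minpoly ℚ pb.gen = F.map (Int.castRingHom ℚ)) (r : ℤ) :
    Algebra.norm ℤ ((r : 𝓞 K) - θ) = F.eval r := by
  have h : Algebra.norm ℚ (algebraMap ℚ K r - pb.gen) = (minpoly ℚ pb.gen).eval (r : ℚ) := by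
    rw [Algebra.norm_eq_matrix_det pb.basis, ← charpoly_leftMulMatrix, Matrix.eval_charpoly,
      map_sub, AlgHom.commutes]
    rfl
  have h' := Algebra.coe_norm_int ((r : 𝓞 K) - θ)
  have : (((r : 𝓞 K) - θ : 𝓞 K) : K) = algebraMap ℚ K r - pb.gen := by
    simp [hθ]
  rw [this, h, hF, Polynomial.eval_intCast_map, eq_intCast] at h'
  exact_mod_cast h'

theorem abs_discr_le_of_integral_basis {ι : Type*} [Fintype ι] [DecidableEq ι]
    (b : Module.Basis ι ℚ K) (hb : ∀ i, IsIntegral ℤ (b i)) :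
    |(discr K : ℚ)| ≤ |Algebra.discr ℚ b| := by
  have hcard : Fintype.card (Module.Free.ChooseBasisIndex ℤ (𝓞 K)) = Fintype.card ι := by
    rw [← Module.finrank_eq_card_basis (integralBasis K), ← Module.finrank_eq_card_basis b]
  let e := Fintype.equivOfCardEq hcard
  let c := (integralBasis K).reindex e
  have hc : (discr K : ℚ) = Algebra.discr ℚ c := by
    rw [coe_discr, Module.Basis.coe_reindex, Algebra.discr_reindex]
  have hdisc : Algebra.discr ℚ b = (c.toMatrix b).det ^ 2 * Algebra.discr ℚ c := by
    rw [← Algebra.discr_of_matrix_vecMul, c.toMatrix_map_vecMul]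
  have hint : IsIntegral ℤ (c.toMatrix b).det := by
    refine IsIntegral.det fun i j => ?_
    rw [Module.Basis.toMatrix_apply, Module.Basis.repr_reindex_apply]
    obtain ⟨x, hx⟩ : ∃ x : 𝓞 K, algebraMap (𝓞 K) K x = b j := ⟨⟨b j, hb j⟩, rfl⟩
    rw [← hx, integralBasis_repr_apply]
    exact isIntegral_algebraMap
  obtain ⟨r, hr⟩ := IsIntegrallyClosed.isIntegral_iff.1 hint
  have hr0 : r ≠ 0 := by
    rintro rfl
    rw [← hr] at hdisc
    simp at hdisc
    exact Algebra.discr_not_zero_of_basis ℚ b hdisc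
  rw [hdisc, ← hr, ← hc, abs_mul]
  refine le_mul_of_one_le_left (abs_nonneg _) ?_
  have : 1 ≤ |r ^ 2| := Int.one_le_abs (pow_ne_zero 2 hr0)
  simp only [eq_intCast]
  exact_mod_cast this

/-- `θ` is a cube root of `7` generating the number field `K`. -/
structure IsCbrtSeven (θ : 𝓞 K) : Prop where
  pow_three : θ ^ 3 = 7
  finrank_eq : Module.finrank ℚ K = 3

namespace IsCbrtSeven

variable {θ : 𝓞 K} (hθ : IsCbrtSeven θ)

theorem irreducible_X_pow_three_sub_seven :
    Irreducible (Polynomial.X ^ 3 - Polynomial.C 7 : Polynomial ℚ) := by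
  refine X_pow_sub_C_irreducible_of_prime Nat.prime_three fun b hb => ?_
  have hint : IsIntegral ℤ b := by
    refine ⟨Polynomial.X ^ 3 - Polynomial.C 7, Polynomial.monic_X_pow_sub_C _ (by norm_num), ?_⟩
    simp [hb]
  obtain ⟨r, rfl⟩ := IsIntegrallyClosed.isIntegral_iff.1 hint
  have hr : r ^ 3 = 7 := by
    rw [eq_intCast] at hb
    exact_mod_cast hb
  have h1 : 1 < r := by
    by_contra! h
    nlinarith [mul_nonneg (sub_nonneg.2 h) (by nlinarith [sq_nonneg (2 * r + 1)] : 0 ≤ r ^ 2 + r + 1)]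
  have h2 : r < 2 := by
    by_contra! h
    nlinarith [mul_nonneg (sub_nonneg.2 h) (sq_nonneg r)]
  omega

include hθ

theorem coe_pow_three : (θ : K) ^ 3 = 7 := by
  have := congrArg (fun x : 𝓞 K => (x : K)) hθ.pow_three
  simpa [map_ofNat (algebraMap (𝓞 K) K)] using this

theorem minpoly_eq : minpoly ℚ (θ : K) = Polynomial.X ^ 3 - Polynomial.C 7 := by
  refine (minpoly.eq_of_irreducible_of_monic irreducible_X_pow_three_sub_seven ?_
    (Polynomial.monic_X_pow_sub_C _ (by norm_num))).symm
  simp [hθ.coe_pow_three]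

theorem exists_powerBasis : ∃ pb : PowerBasis ℚ K, pb.gen = θ := by
  have h : IntermediateField.adjoin ℚ {(θ : K)} = ⊤ := by
    rw [Field.primitive_element_iff_minpoly_natDegree_eq, hθ.minpoly_eq, hθ.finrank_eq]
    exact Polynomial.natDegree_X_pow_sub_C
  have h' : Algebra.adjoin ℚ {(θ : K)} = ⊤ := by
    rw [← IntermediateField.adjoin_simple_toSubalgebra_of_isAlgebraic
      (Algebra.IsAlgebraic.isAlgebraic _), h, IntermediateField.top_toSubalgebra]
  exact ⟨.ofAdjoinEqTop (Algebra.IsIntegral.isIntegral _) h', PowerBasis.ofAdjoinEqTop_gen _ _⟩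

theorem norm_intCast_sub (r : ℤ) : Algebra.norm ℤ ((r : 𝓞 K) - θ) = r ^ 3 - 7 := by
  obtain ⟨pb, hpb⟩ := hθ.exists_powerBasis
  rw [norm_intCast_sub_of_minpoly (F := Polynomial.X ^ 3 - Polynomial.C 7) pb hpb.symm]
  · simp
  · rw [hpb, hθ.minpoly_eq]
    simp
    rfl

theorem norm_intCast (r : ℤ) : Algebra.norm ℤ (r : 𝓞 K) = r ^ 3 := by
  have := Algebra.norm_algebraMap (S := 𝓞 K) r
  rw [RingOfIntegers.rank, hθ.finrank_eq] at this
  simpa using this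

theorem norm_self : Algebra.norm ℤ θ = 7 := by
  have := hθ.norm_intCast_sub 0
  rw [show ((0 : ℤ) : 𝓞 K) - θ = ((-1 : ℤ) : 𝓞 K) * θ by push_cast; ring, map_mul,
    hθ.norm_intCast] at this
  linarith

theorem abs_discr_le : |(discr K : ℚ)| ≤ 1323 := by
  obtain ⟨pb, hpb⟩ := hθ.exists_powerBasis
  refine (abs_discr_le_of_integral_basis pb.basis fun i => ?_).trans ?_
  · rw [pb.basis_eq_pow, hpb]
    exact (RingOfIntegers.isIntegral_coe θ).pow _
  · rw [Algebra.discr_powerBasis_eq_norm, hpb, hθ.minpoly_eq]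
    have : Polynomial.aeval (θ : K) (Polynomial.X ^ 3 - Polynomial.C 7 : Polynomial ℚ).derivative
        = ((((3 : ℤ) : 𝓞 K) * θ ^ 2 : 𝓞 K) : K) := by
      simp [map_ofNat (algebraMap (𝓞 K) K)]
      norm_num
    rw [this, ← Algebra.coe_norm_int, map_mul, map_pow, hθ.norm_self, hθ.norm_intCast, abs_mul,
      abs_pow]
    norm_num

theorem card_infinitePlace : Fintype.card (InfinitePlace K) = 2 := by
  have h1 := InfinitePlace.card_eq_nrRealPlaces_add_nrComplexPlaces K
  have h2 := InfinitePlace.card_add_two_mul_card_eq_rank K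
  rw [hθ.finrank_eq] at h2
  have h3 : InfinitePlace.nrComplexPlaces K ≠ 0 := by
    intro h0
    rw [nrComplexPlaces_eq_zero_iff] at h0
    have hsub : Subsingleton (K →+* ℂ) := by
      obtain ⟨pb, hpb⟩ := hθ.exists_powerBasis
      have key (χ : K →+* ℂ) : ((χ θ).re : ℂ) = χ θ ∧ (χ θ).re ^ 3 = 7 := by
        have hre : ((χ θ).re : ℂ) = χ θ :=
          Complex.conj_eq_iff_re.1 (RingHom.congr_fun
            (ComplexEmbedding.isReal_iff.1 (IsTotallyReal.complexEmbedding_isReal χ)) (θ : K))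
        refine ⟨hre, ?_⟩
        have h7 : χ θ ^ 3 = 7 := by
          rw [← map_pow, hθ.coe_pow_three, map_ofNat]
        rw [← hre] at h7
        exact_mod_cast h7
      refine ⟨fun φ ψ => ?_⟩
      have hφψ : φ θ = ψ θ := by
        rw [← (key φ).1, ← (key ψ).1, (Odd.strictMono_pow (R := ℝ) (n := 3) (by decide)).injective
          ((key φ).2.trans (key ψ).2.symm)]
      have : φ.toRatAlgHom = ψ.toRatAlgHom := pb.algHom_ext (by rw [hpb]; exact hφψ)
      exact RingHom.ext fun x => DFunLike.congr_fun this x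
    have := Embeddings.card K ℂ
    have := Fintype.card_le_one_iff_subsingleton.2 hsub
    rw [hθ.finrank_eq] at *
    omega
  omega

omit hθ

theorem pow_eq_span_of_mem {Q : Ideal (𝓞 K)} {η : 𝓞 K} {k : ℕ} (hη : η ∈ Q ^ k)
    (h0 : Algebra.norm ℤ η ≠ 0)
    (hN : (Algebra.norm ℤ η).natAbs = Ideal.absNorm Q ^ k) : Q ^ k = Ideal.span {η} := by
  obtain ⟨J, hJ⟩ := Ideal.dvd_iff_le.2 ((Ideal.span_singleton_le_iff_mem _).2 hη)
  have hJN := congrArg Ideal.absNorm hJ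
  rw [Ideal.absNorm_span_singleton, map_mul, map_pow, hN] at hJN
  have hJ1 : Ideal.absNorm J = 1 := by
    rw [← hN] at hJN
    exact (Nat.eq_of_mul_eq_mul_left (Int.natAbs_pos.2 h0) (by rw [mul_one]; exact hJN)).symm
  rw [hJ, Ideal.absNorm_eq_one_iff.1 hJ1, Ideal.mul_top]

theorem pow_eq_span_of_mem_of_prime {Q : Ideal (𝓞 K)} (hQ : Q ≠ ⊤) {η : 𝓞 K} {k q : ℕ}
    (hk : k ≠ 0) (hq : q.Prime) (hη : η ∈ Q ^ k)
    (hN : (Algebra.norm ℤ η).natAbs = q ^ k) : Q ^ k = Ideal.span {η} := by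
  have hdvd := Ideal.absNorm_dvd_absNorm_of_le ((Ideal.span_singleton_le_iff_mem _).2 hη)
  rw [Ideal.absNorm_span_singleton, hN, map_pow, Nat.pow_dvd_pow_iff hk,
    Nat.dvd_prime hq, Ideal.absNorm_eq_one_iff] at hdvd
  refine pow_eq_span_of_mem hη ?_ (by rw [hN, hdvd.resolve_left hQ])
  rw [← Int.natAbs_ne_zero, hN]
  exact pow_ne_zero _ hq.ne_zero

theorem pow_sub_self_mem_of_absNorm_eq {Q : Ideal (𝓞 K)} [Q.IsPrime] {q : ℕ} (hq : q ≠ 0)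
    (hQ : Ideal.absNorm Q = q) (x : 𝓞 K) : x ^ q - x ∈ Q := by
  have hQ0 : Q ≠ ⊥ := by
    rintro rfl
    rw [Ideal.absNorm_bot] at hQ
    exact hq hQ.symm
  have : Q.IsMaximal := Ring.DimensionLEOne.maximalOfPrime hQ0 inferInstance
  let := Ideal.Quotient.field Q
  have : Finite (𝓞 K ⧸ Q) := (Ideal.absNorm_ne_zero_iff Q).1 (hQ ▸ hq)
  let := Fintype.ofFinite (𝓞 K ⧸ Q)
  have hcard : Fintype.card (𝓞 K ⧸ Q) = q := by
    rw [← hQ, Ideal.absNorm_apply, Submodule.cardQuot_apply, Nat.card_eq_fintype_card]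
  rw [← Ideal.Quotient.eq_zero_iff_mem, map_sub, map_pow, ← hcard, FiniteField.pow_card, sub_self]

omit [NumberField K] in
theorem mul_mul_mem_pow_three {Q : Ideal (𝓞 K)} {a b c : 𝓞 K} (ha : a ∈ Q) (hb : b ∈ Q)
    (hc : c ∈ Q) : a * b * c ∈ Q ^ 3 := by
  rw [pow_three']
  exact Ideal.mul_mem_mul (Ideal.mul_mem_mul ha hb) hc

include hθ

theorem natAbs_norm_intCast_add (r : ℤ) :
    (Algebra.norm ℤ ((r : 𝓞 K) + θ)).natAbs = (r ^ 3 + 7).natAbs := by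
  rw [show (r : 𝓞 K) + θ = ((-1 : ℤ) : 𝓞 K) * (((-r : ℤ) : 𝓞 K) - θ) by push_cast; ring,
    map_mul, hθ.norm_intCast, hθ.norm_intCast_sub,
    show (-1 : ℤ) ^ 3 * ((-r) ^ 3 - 7) = r ^ 3 + 7 by ring]

theorem exists_pow_three_eq_span_of_two_mem {Q : Ideal (𝓞 K)} [Q.IsPrime] (h2 : (2 : 𝓞 K) ∈ Q) :
    ∃ η : 𝓞 K, Q ^ 3 = Ideal.span {η} := by
  have hQ : Q ≠ ⊤ := Ideal.IsPrime.ne_top inferInstance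
  have h3 := hθ.pow_three
  have h8 : (8 : 𝓞 K) ∈ Q ^ 3 := by
    convert! mul_mul_mem_pow_three h2 h2 h2 using 1
    norm_num
  have hfac : (1 + θ) * (1 - θ + θ ^ 2) = 8 := by linear_combination h3
  have hN : (Algebra.norm ℤ (1 + θ)).natAbs = 8 := by
    have := hθ.natAbs_norm_intCast_add 1
    simpa using this
  have hN' : (Algebra.norm ℤ (1 - θ + θ ^ 2)).natAbs = 64 := by
    have := congrArg (fun x => (Algebra.norm ℤ x).natAbs) hfac
    have h := hθ.norm_intCast 8
    push_cast at h
    simp only [map_mul, Int.natAbs_mul, hN, h] at this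
    norm_num at this
    omega
  have hmem : (1 + θ) * (1 - θ + θ ^ 2) ∈ Q := by
    rw [hfac]
    exact Ideal.pow_le_self three_ne_zero h8
  rcases Ideal.IsPrime.mem_or_mem inferInstance hmem with h | h
  · refine ⟨1 + θ, pow_eq_span_of_mem_of_prime hQ three_ne_zero Nat.prime_two ?_ hN⟩
    have : 1 + θ = θ ^ 2 * ((1 + θ) * (1 + θ) * (1 + θ)) - θ ^ 2 * 8 - 5 * (2 * 2 * (1 + θ)) := by
      linear_combination (-3 * θ - 3 - θ ^ 2) * h3
    rw [this]
    exact Ideal.sub_mem _ (Ideal.sub_mem _ (Ideal.mul_mem_left _ _ (mul_mul_mem_pow_three h h h))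
      (Ideal.mul_mem_left _ _ h8)) (Ideal.mul_mem_left _ _ (mul_mul_mem_pow_three h2 h2 h))
  · set π := 1 - θ + θ ^ 2 with hπ
    have hmem : π ∈ Q ^ 3 := by
      have : π = π * π * π - 2 * (2 * 2 * π) - (3 * θ + 2 - 3 * π) * 8 := by
        rw [hπ]
        linear_combination (-(θ ^ 3) + 3 * θ ^ 2 - 6 * θ) * h3
      rw [this]
      exact Ideal.sub_mem _ (Ideal.sub_mem _ (mul_mul_mem_pow_three h h h)
        (Ideal.mul_mem_left _ _ (mul_mul_mem_pow_three h2 h2 h))) (Ideal.mul_mem_left _ _ h8)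
    refine ⟨π, pow_eq_span_of_mem hmem (by rw [← Int.natAbs_ne_zero, hN']; norm_num) ?_⟩
    have hdvd := Ideal.absNorm_dvd_absNorm_of_le ((Ideal.span_singleton_le_iff_mem _).2 hmem)
    rw [Ideal.absNorm_span_singleton, hN', map_pow, show 64 = 4 ^ 3 by norm_num,
      Nat.pow_dvd_pow_iff three_ne_zero, show 4 = 2 ^ 2 by norm_num,
      Nat.dvd_prime_pow Nat.prime_two] at hdvd
    obtain ⟨k, hk, hk'⟩ := hdvd
    rw [hN', hk']
    interval_cases k
    · exact absurd (Ideal.absNorm_eq_one_iff.1 hk') hQ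
    · refine absurd ((Ideal.eq_top_iff_one Q).2 ?_) hQ
      have := Ideal.sub_mem _ h (pow_sub_self_mem_of_absNorm_eq two_ne_zero hk' θ)
      rw [hπ] at this
      convert! this using 1
      ring
    · norm_num

theorem exists_pow_three_eq_span_of_three_mem {Q : Ideal (𝓞 K)} [Q.IsPrime]
    (h3Q : (3 : 𝓞 K) ∈ Q) : ∃ η : 𝓞 K, Q ^ 3 = Ideal.span {η} := by
  have hQ : Q ≠ ⊤ := Ideal.IsPrime.ne_top inferInstance
  have h3 := hθ.pow_three
  have h : θ - 1 ∈ Q := by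
    refine Ideal.IsPrime.mem_of_pow_mem inferInstance 3 ?_
    rw [show (θ - 1) ^ 3 = (2 + θ - θ ^ 2) * 3 by linear_combination h3]
    exact Ideal.mul_mem_left _ _ h3Q
  refine ⟨3, pow_eq_span_of_mem_of_prime hQ three_ne_zero Nat.prime_three ?_ ?_⟩
  · have : (3 : 𝓞 K) = θ ^ 2 * (1 + θ) * (4 + 2 * θ + θ ^ 2) * ((θ - 1) * (θ - 1) * (θ - 1))
        - θ ^ 2 * (3 * (θ - 1) * (θ - 1)) - 3 * (3 * 3 * 3) := by
      have e1 : (4 + 2 * θ + θ ^ 2) * ((θ - 1) * (θ - 1) * (θ - 1)) = 3 * (1 + θ) := by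
        linear_combination (θ ^ 2 - θ + 1) * h3
      linear_combination -θ ^ 2 * (1 + θ) * e1 - 12 * h3
    rw [this]
    exact Ideal.sub_mem _ (Ideal.sub_mem _ (Ideal.mul_mem_left _ _ (mul_mul_mem_pow_three h h h))
      (Ideal.mul_mem_left _ _ (mul_mul_mem_pow_three h3Q h h)))
      (Ideal.mul_mem_left _ _ (mul_mul_mem_pow_three h3Q h3Q h3Q))
  · have := hθ.norm_intCast 3
    push_cast at this
    rw [this]
    norm_num

theorem exists_pow_three_eq_span_of_absNorm_eq_five {Q : Ideal (𝓞 K)} [Q.IsPrime]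
    (hQ5 : Ideal.absNorm Q = 5) : ∃ η : 𝓞 K, Q ^ 3 = Ideal.span {η} := by
  have hQ : Q ≠ ⊤ := Ideal.IsPrime.ne_top inferInstance
  have h3 := hθ.pow_three
  have h5 : (5 : 𝓞 K) ∈ Q := by
    have := Ideal.absNorm_mem Q
    rw [hQ5] at this
    exact_mod_cast this
  have h : θ - 3 ∈ Q := by
    have hmem : θ * (7 * θ - 1) ∈ Q := by
      convert! pow_sub_self_mem_of_absNorm_eq (by norm_num) hQ5 θ using 1
      linear_combination -θ ^ 2 * h3
    rcases Ideal.IsPrime.mem_or_mem inferInstance hmem with h | h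
    · refine absurd ((Ideal.eq_top_iff_one Q).2 ?_) hQ
      rw [show (1 : 𝓞 K) = 3 * 5 - 2 * θ ^ 2 * θ by linear_combination 2 * h3]
      exact Ideal.sub_mem _ (Ideal.mul_mem_left _ _ h5) (Ideal.mul_mem_left _ _ h)
    · rw [show θ - 3 = 3 * (7 * θ - 1) - 4 * θ * 5 by ring]
      exact Ideal.sub_mem _ (Ideal.mul_mem_left _ _ h) (Ideal.mul_mem_left _ _ h5)
  set ζ := θ - 3 with hζ
  have h555 := mul_mul_mem_pow_three h5 h5 h5
  have h55ζ := mul_mul_mem_pow_three h5 h5 h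
  have hs : θ ^ 2 - 33 * θ + 70 ∈ Q ^ 3 := by
    rw [show θ ^ 2 - 33 * θ + 70 = ζ * ζ * ζ + 2 * (5 * ζ * ζ) by
      rw [hζ]; linear_combination -h3]
    exact Ideal.add_mem _ (mul_mul_mem_pow_three h h h)
      (Ideal.mul_mem_left _ _ (mul_mul_mem_pow_three h5 h h))
  have ht : θ - 43 ∈ Q ^ 3 := by
    rw [show θ - 43 = 5 * 5 * ζ - 4 * ((θ + 33) * (θ ^ 2 - 33 * θ + 70)
      + 41 * (5 * 5 * ζ)) - 24 * (5 * 5 * 5) by rw [hζ]; linear_combination 4 * h3]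
    refine Ideal.sub_mem _ (Ideal.sub_mem _ h55ζ
      (Ideal.mul_mem_left _ _ (Ideal.add_mem _ (Ideal.mul_mem_left _ _ hs)
        (Ideal.mul_mem_left _ _ h55ζ)))) (Ideal.mul_mem_left _ _ h555)
  refine ⟨5 + 4 * θ + 2 * θ ^ 2,
    pow_eq_span_of_mem_of_prime hQ three_ne_zero Nat.prime_five ?_ ?_⟩
  · rw [show 5 + 4 * θ + 2 * θ ^ 2 = 2 * (θ ^ 2 - 33 * θ + 70) + 70 * (θ - 43)
      + 23 * (5 * 5 * 5) by ring]
    exact Ideal.add_mem _ (Ideal.add_mem _ (Ideal.mul_mem_left _ _ hs)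
      (Ideal.mul_mem_left _ _ ht)) (Ideal.mul_mem_left _ _ h555)
  · have hcube : 3 * (5 + 4 * θ + 2 * θ ^ 2) = (2 + θ) ^ 3 := by linear_combination -h3
    have h15 := hθ.natAbs_norm_intCast_add 2
    have h27 := hθ.norm_intCast 3
    push_cast at h15 h27
    have := congrArg (fun x => (Algebra.norm ℤ x).natAbs) hcube
    simp only [map_mul, map_pow, Int.natAbs_mul, Int.natAbs_pow, h15, h27] at this
    norm_num at this
    omega

theorem exists_pow_three_eq_span_of_seven_mem {Q : Ideal (𝓞 K)} [Q.IsPrime]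
    (h7 : (7 : 𝓞 K) ∈ Q) : ∃ η : 𝓞 K, Q ^ 3 = Ideal.span {η} := by
  have hQ : Q ≠ ⊤ := Ideal.IsPrime.ne_top inferInstance
  have h : θ ∈ Q := Ideal.IsPrime.mem_of_pow_mem inferInstance 3 (hθ.pow_three ▸ h7)
  refine ⟨θ ^ 3, pow_eq_span_of_mem_of_prime hQ three_ne_zero (by norm_num : Nat.Prime 7)
    (Ideal.pow_mem_pow h 3) ?_⟩
  rw [map_pow, hθ.norm_self]
  rfl

theorem exists_pow_three_eq_span_of_absNorm_le {Q : Ideal (𝓞 K)} [Q.IsPrime] (hQ0 : Q ≠ ⊥)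
    (hQ : Ideal.absNorm Q ≤ 10) : ∃ η : 𝓞 K, Q ^ 3 = Ideal.span {η} := by
  have : Q.IsMaximal := Ring.DimensionLEOne.maximalOfPrime hQ0 inferInstance
  obtain ⟨p, n, hn, hpQ, hp, hN⟩ := Ideal.exists_prime_and_absNorm_eq_pow Q
  have hle : p ≤ 10 := (Nat.le_self_pow hn.ne' p).trans (hN ▸ hQ)
  interval_cases p <;> try (exfalso; revert hp; norm_num; done)
  · exact hθ.exists_pow_three_eq_span_of_two_mem (by exact_mod_cast hpQ)
  · exact hθ.exists_pow_three_eq_span_of_three_mem (by exact_mod_cast hpQ)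
  · have hn1 : n = 1 := by
      by_contra h
      have : 5 ^ 2 ≤ 5 ^ n := Nat.pow_le_pow_right (by norm_num) (by omega)
      omega
    exact hθ.exists_pow_three_eq_span_of_absNorm_eq_five (by rw [hN, hn1, pow_one])
  · exact hθ.exists_pow_three_eq_span_of_seven_mem (by exact_mod_cast hpQ)

theorem minkowskiBound_lt : (4 / Real.pi) ^ InfinitePlace.nrComplexPlaces K *
    ((Module.finrank ℚ K).factorial / (Module.finrank ℚ K) ^ (Module.finrank ℚ K) *
      √|(discr K : ℝ)|) < 11 := by
  have hr2 : InfinitePlace.nrComplexPlaces K ≤ 1 := by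
    have := InfinitePlace.card_add_two_mul_card_eq_rank K
    rw [hθ.finrank_eq] at this
    omega
  have hπ : (1 : ℝ) ≤ 4 / Real.pi := by
    rw [one_le_div Real.pi_pos]
    exact Real.pi_le_four
  have hπ' : 4 / Real.pi ≤ 1.274 := by
    rw [div_le_iff₀ Real.pi_pos]
    linarith [Real.pi_gt_d2]
  have hpow : (4 / Real.pi) ^ InfinitePlace.nrComplexPlaces K ≤ 1.274 :=
    (pow_le_pow_right₀ hπ hr2).trans (by rwa [pow_one])
  have hsqrt : √|(discr K : ℝ)| ≤ 37 := by
    rw [Real.sqrt_le_left (by norm_num)]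
    have := hθ.abs_discr_le
    have : |(discr K : ℝ)| ≤ 1323 := by exact_mod_cast this
    linarith
  rw [hθ.finrank_eq]
  calc _ ≤ 1.274 * ((Nat.factorial 3 : ℝ) / (3 : ℕ) ^ 3 * 37) := by gcongr
    _ < 11 := by norm_num [Nat.factorial]

theorem classGroup_pow_three (c : ClassGroup (𝓞 K)) : c ^ 3 = 1 := by
  obtain ⟨I, rfl, hI⟩ := exists_ideal_in_class_of_norm_le c
  have hI10 : Ideal.absNorm (I : Ideal (𝓞 K)) ≤ 10 := by
    have := hI.trans_lt hθ.minkowskiBound_lt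
    have : Ideal.absNorm (I : Ideal (𝓞 K)) < 11 := by exact_mod_cast this
    omega
  have hmap (m : Multiset (Ideal (𝓞 K))) : m.prod ^ 3 = (m.map fun J => J ^ 3).prod :=
    (Multiset.prod_hom m (powMonoidHom 3)).symm
  rw [← map_pow, ClassGroup.mk0_eq_one_iff, SubmonoidClass.coe_pow,
    ← Ideal.mem_isPrincipalSubmonoid_iff,
    ← Ideal.prod_normalizedFactors_eq_self (nonZeroDivisors.coe_ne_zero I), hmap]
  refine Submonoid.multiset_prod_mem _ _ fun J hJ => ?_
  obtain ⟨P, hP, rfl⟩ := Multiset.mem_map.1 hJ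
  have hprime := ((Ideal.mem_normalizedFactors_iff (nonZeroDivisors.coe_ne_zero I)).1 hP).1
  have hdvd := UniqueFactorizationMonoid.dvd_of_mem_normalizedFactors hP
  have hP0 : P ≠ ⊥ := ne_zero_of_dvd_ne_zero (nonZeroDivisors.coe_ne_zero I) hdvd
  obtain ⟨η, hη⟩ := hθ.exists_pow_three_eq_span_of_absNorm_le hP0
    ((Nat.le_of_dvd (Ideal.absNorm_pos_of_nonZeroDivisors I)
      (Ideal.absNorm_dvd_absNorm_of_le (Ideal.le_of_dvd hdvd))).trans hI10)
  rw [Ideal.mem_isPrincipalSubmonoid_iff]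
  exact ⟨η, hη⟩

theorem isPrincipal_of_pow_seven {I : Ideal (𝓞 K)} (hI0 : I ≠ ⊥)
    (hI : (I ^ 7).IsPrincipal) : I.IsPrincipal := by
  let I' : nonZeroDivisors (Ideal (𝓞 K)) := ⟨I, mem_nonZeroDivisors_of_ne_zero hI0⟩
  have h7 : ClassGroup.mk0 I' ^ 7 = 1 := by
    rw [← map_pow, ClassGroup.mk0_eq_one_iff]
    exact hI
  rw [show 7 = 3 * 2 + 1 by rfl, pow_succ, pow_mul, hθ.classGroup_pow_three, one_pow, one_mul,
    ClassGroup.mk0_eq_one_iff] at h7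
  exact h7

theorem dvd_intCast_iff (a : ℤ) : θ ∣ (a : 𝓞 K) ↔ 7 ∣ a := by
  constructor
  · intro h
    have := map_dvd (Algebra.norm ℤ) h
    rw [hθ.norm_self, hθ.norm_intCast] at this
    exact (by norm_num : Prime (7 : ℤ)).dvd_of_dvd_pow this
  · rintro ⟨b, rfl⟩
    refine ⟨θ ^ 2 * b, ?_⟩
    push_cast
    linear_combination (-(b : 𝓞 K)) * hθ.pow_three

theorem ne_zero : θ ≠ 0 := by
  rintro rfl
  have := hθ.pow_three
  norm_num at this

theorem seven_dvd_coeff {a b c : ℤ} (h : (7 : 𝓞 K) ∣ a + b * θ + c * θ ^ 2) :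
    7 ∣ a ∧ 7 ∣ b ∧ 7 ∣ c := by
  have h3 := hθ.pow_three
  rw [← h3] at h
  have ha : θ ∣ (a : 𝓞 K) := by
    have h1 := (Dvd.intro_left (θ ^ 2) (by ring) : θ ∣ θ ^ 3).trans h
    have h2 : θ ∣ b * θ + c * θ ^ 2 := ⟨b + c * θ, by ring⟩
    rw [add_assoc] at h1
    exact (dvd_add_left h2).1 h1
  have ha7 := (hθ.dvd_intCast_iff a).1 ha
  have hbc : θ ^ 2 ∣ b + c * θ := by
    obtain ⟨a', rfl⟩ := ha7
    have h1 : θ * θ ^ 2 ∣ θ * (b + c * θ) := by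
      have h2 : θ ^ 3 ∣ ((7 * a' : ℤ) : 𝓞 K) := ⟨a', by push_cast; rw [h3]⟩
      rw [add_assoc, dvd_add_right h2] at h
      convert h using 1 <;> ring
    exact (mul_dvd_mul_iff_left hθ.ne_zero).1 h1
  have hb : θ ∣ (b : 𝓞 K) :=
    (dvd_add_left (Dvd.intro_left (c : 𝓞 K) rfl)).1 ((dvd_pow_self θ two_ne_zero).trans hbc)
  have hb7 := (hθ.dvd_intCast_iff b).1 hb
  refine ⟨ha7, hb7, (hθ.dvd_intCast_iff c).1 ?_⟩
  obtain ⟨b', rfl⟩ := hb7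
  have h1 : θ ^ 2 ∣ ((7 * b' : ℤ) : 𝓞 K) := ⟨θ * b', by push_cast; linear_combination -b' * h3⟩
  have h2 : θ * θ ∣ θ * c := by
    rw [dvd_add_right h1] at hbc
    convert hbc using 1 <;> ring
  exact (mul_dvd_mul_iff_left hθ.ne_zero).1 h2

theorem exists_dvd_sub_intCast (α : 𝓞 K) : ∃ r : ℤ, θ ∣ α - r := by
  have hN : Ideal.absNorm (Ideal.span {θ}) = 7 := by
    rw [Ideal.absNorm_span_singleton, hθ.norm_self]
    rfl
  have hcard : Nat.card (𝓞 K ⧸ Ideal.span {θ}) = 7 := by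
    rw [← hN, Ideal.absNorm_apply, Submodule.cardQuot_apply]
  have : Fact (Nat.card (𝓞 K ⧸ Ideal.span {θ})).Prime := ⟨by rw [hcard]; norm_num⟩
  rcases (AddSubgroup.zmultiples (1 : 𝓞 K ⧸ Ideal.span {θ})).eq_bot_or_eq_top_of_prime_card
    with h | h
  · rw [AddSubgroup.zmultiples_eq_bot] at h
    have : Subsingleton (𝓞 K ⧸ Ideal.span {θ}) := subsingleton_of_zero_eq_one h.symm
    rw [Nat.card_unique] at hcard
    norm_num at hcard
  · obtain ⟨r, hr⟩ := AddSubgroup.mem_zmultiples_iff.1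
      (h ▸ AddSubgroup.mem_top (Ideal.Quotient.mk (Ideal.span {θ}) α))
    refine ⟨r, ?_⟩
    rw [← Ideal.mem_span_singleton, ← Ideal.Quotient.eq_zero_iff_mem, map_sub, ← hr, map_intCast,
      zsmul_one, sub_self]

theorem exists_seven_dvd_pow_seven_sub_intCast (α : 𝓞 K) : ∃ r : ℤ, (7 : 𝓞 K) ∣ α ^ 7 - r := by
  obtain ⟨r, β, hβ⟩ := hθ.exists_dvd_sub_intCast α
  obtain ⟨s, hs⟩ := exists_add_pow_prime_eq (by norm_num : Nat.Prime 7) (r : 𝓞 K) (θ * β)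
  refine ⟨r ^ 7, 7 * θ * β ^ 7 + r * (θ * β) * s, ?_⟩
  rw [sub_eq_iff_eq_add'.1 hβ, hs]
  push_cast
  linear_combination (θ ^ 4 * β ^ 7 + 7 * θ * β ^ 7) * hθ.pow_three

/-- The unit `2 - θ`. -/
noncomputable def unit : (𝓞 K)ˣ where
  val := 2 - θ
  inv := 4 + 2 * θ + θ ^ 2
  val_inv := by linear_combination -hθ.pow_three
  inv_val := by linear_combination -hθ.pow_three

theorem exists_unit_generator : ∃ η : (𝓞 K)ˣ, ∀ u : (𝓞 K)ˣ,
    ∃ w : (𝓞 K)ˣ, w ^ 7 = w ∧ ∃ k : ℤ, u = w * η ^ k := by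
  have hrank : Units.rank K = 1 := by rw [Units.rank, hθ.card_infinitePlace]
  let i₀ : Fin (Units.rank K) := ⟨0, by omega⟩
  have : Unique (Fin (Units.rank K)) := ⟨⟨i₀⟩, fun i => by
    ext; have := i.2; simp only [i₀]; omega⟩
  refine ⟨Units.fundSystem K default, fun u => ?_⟩
  obtain ⟨⟨w, f⟩, h, -⟩ := Units.exist_unique_eq_mul_prod K u
  refine ⟨w, ?_, f default, ?_⟩
  · rcases Units.torsion_eq_one_or_neg_one_of_odd_finrank (by rw [hθ.finrank_eq]; decide) w
      with h | h <;> rw [h]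
    · rw [one_pow]
    · exact Odd.neg_one_pow (by decide)
  · rw [h, Fintype.prod_unique]

theorem unit_ne_pow_seven_mul (v : (𝓞 K)ˣ) : hθ.unit ≠ v ^ 7 := by
  intro h
  obtain ⟨r, hr⟩ := hθ.exists_seven_dvd_pow_seven_sub_intCast (v : 𝓞 K)
  have h' : (2 - θ : 𝓞 K) = (v : 𝓞 K) ^ 7 := by
    rw [← Units.val_pow_eq_pow_val, ← h]
    rfl
  rw [← h'] at hr
  have := hθ.seven_dvd_coeff (a := 2 - r) (b := -1) (c := 0) (by
    convert hr using 1
    push_cast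
    ring)
  omega

theorem exists_eq_pow_seven_mul_unit_pow (u : (𝓞 K)ˣ) :
    ∃ (v : (𝓞 K)ˣ) (e : ℕ), u = v ^ 7 * hθ.unit ^ e := by
  obtain ⟨η, hη⟩ := hθ.exists_unit_generator
  obtain ⟨w, hw, m, hm⟩ := hη hθ.unit
  have hm7 : ¬ 7 ∣ m := by
    rintro ⟨j, rfl⟩
    refine hθ.unit_ne_pow_seven_mul (w * η ^ j) ?_
    rw [hm, mul_pow, hw, mul_comm 7 j, zpow_mul]
    norm_cast
  have hcop : IsCoprime (7 : ℤ) m := ((by norm_num : Prime (7 : ℤ)).coprime_iff_not_dvd).2 hm7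
  obtain ⟨t, s, hst⟩ := hcop
  obtain ⟨w', hw', k, rfl⟩ := hη u
  refine ⟨w' * w ^ (-(s * k)) * hθ.unit ^ (s * k / 7) * η ^ (t * k), (s * k % 7).toNat, ?_⟩
  have hε : hθ.unit ^ (s * k) = w ^ (s * k) * η ^ (m * (s * k)) := by
    rw [hm, mul_zpow, zpow_mul η]
  have hw7 : w ^ (-(s * k) * 7) = w ^ (-(s * k)) := by
    rw [mul_comm, zpow_mul]
    norm_cast
    rw [hw]
  have hsplit : hθ.unit ^ (s * k / 7 * 7) * hθ.unit ^ (s * k % 7) = hθ.unit ^ (s * k) := by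
    rw [← zpow_add, mul_comm, Int.mul_ediv_add_emod]
  have hpow : ∀ (x : (𝓞 K)ˣ) (j : ℤ), (x ^ j) ^ 7 = x ^ (j * 7) := fun x j => by
    rw [zpow_mul]
    norm_cast
  have hk : η ^ k = η ^ (m * (s * k)) * η ^ (t * k * 7) := by
    rw [← zpow_add]
    congr 1
    linear_combination -k * hst
  have he : hθ.unit ^ (s * k % 7).toNat = hθ.unit ^ (s * k % 7) := by
    rw [← zpow_natCast, Int.toNat_of_nonneg (Int.emod_nonneg _ (by norm_num))]
  rw [he, mul_pow, mul_pow, mul_pow, hpow, hpow, hpow, hw', hw7, hk]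
  calc w' * (η ^ (m * (s * k)) * η ^ (t * k * 7))
      = w' * w ^ (-(s * k)) * (w ^ (s * k) * η ^ (m * (s * k))) * η ^ (t * k * 7) := by
        rw [zpow_neg]; group
    _ = w' * w ^ (-(s * k)) * (hθ.unit ^ (s * k / 7 * 7) * hθ.unit ^ (s * k % 7))
        * η ^ (t * k * 7) := by rw [hsplit, hε]
    _ = _ := by
        simp only [mul_assoc]
        rw [mul_comm (hθ.unit ^ (s * k % 7))]

theorem exists_unit_pow_mul_eq (e : ℕ) : ∃ a b c : ℤ,
    (2 - θ) ^ e * (64 + θ ^ 2) ^ 4 = a + b * θ + c * θ ^ 2 ∧ 7 ∣ a - 2 ^ e ∧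
      7 ∣ 2 * b + e * 2 ^ e ∧ 7 ∣ c - 2 ^ e * (e ^ 2 - e + 4) := by
  have h3 := hθ.pow_three
  induction e with
  | zero =>
    refine ⟨16777216 + 7 ^ 2 * 256, 7 * 24576, 4 * 64 ^ 3 + 49, ?_, ?_, ?_, ?_⟩
    · push_cast
      linear_combination (24576 * θ + 256 * (θ ^ 3 + 7) + θ ^ 2 * (θ ^ 3 + 7)) * h3
    all_goals norm_num
  | succ e ih =>
    obtain ⟨a, b, c, h, ⟨a', ha⟩, ⟨b', hb⟩, ⟨c', hc⟩⟩ := ih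
    refine ⟨2 * a - 7 * c, 2 * b - a, 2 * c - b, ?_, ?_, ?_, ?_⟩
    · rw [pow_succ']
      push_cast
      linear_combination (2 - θ) * h - c * h3
    · exact ⟨2 * a' - c, by rw [pow_succ]; linear_combination 2 * ha⟩
    · refine ⟨2 * b' - 2 * a', ?_⟩
      push_cast
      rw [pow_succ]
      linear_combination 2 * hb - 2 * ha
    · refine ⟨2 * c' - 4 * b' + b, ?_⟩
      push_cast
      rw [pow_succ]
      linear_combination 2 * hc - 4 * hb

theorem add_mul_ne_unit_mul {x y : ℤ} (hx : ¬ 7 ∣ x) (u : (𝓞 K)ˣ) (α : 𝓞 K) :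
    (x + y * θ : 𝓞 K) ≠ u * (64 + θ ^ 2) ^ 4 * α ^ 7 := by
  intro h
  obtain ⟨v, e, rfl⟩ := hθ.exists_eq_pow_seven_mul_unit_pow u
  obtain ⟨r, β, hr⟩ := hθ.exists_seven_dvd_pow_seven_sub_intCast (v * α)
  obtain ⟨a, b, c, habc, ha, hb, hc⟩ := hθ.exists_unit_pow_mul_eq e
  have hval : ((hθ.unit : (𝓞 K)ˣ) : 𝓞 K) = 2 - θ := rfl
  simp only [Units.val_mul, Units.val_pow_eq_pow_val, hval] at h
  have key := hθ.seven_dvd_coeff (a := x - r * a) (b := y - r * b) (c := -(r * c))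
    ⟨β * (a + b * θ + c * θ ^ 2), by
      push_cast
      linear_combination h + (v * α : 𝓞 K) ^ 7 * habc + (a + b * θ + c * θ ^ 2) * hr⟩
  have h7 : Prime (7 : ℤ) := by norm_num
  have hc7 : ¬ 7 ∣ c := by
    intro h
    rcases h7.dvd_or_dvd ((dvd_sub_right h).1 hc) with h | h
    · exact absurd (h7.dvd_of_dvd_pow h) (by norm_num)
    · have h' : ((e ^ 2 - e + 4 : ℤ) : ZMod 7) = 0 := (ZMod.intCast_zmod_eq_zero_iff_dvd _ 7).2 h
      push_cast at h'
      generalize (e : ZMod 7) = z at h'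
      revert z
      decide
  obtain ⟨s, rfl⟩ := (h7.dvd_or_dvd (dvd_neg.1 key.2.2)).resolve_right hc7
  exact hx ((dvd_sub_left ⟨s * a, by ring⟩).1 key.1)

theorem isCoprime_of_pow_three_add {x y : ℤ} (hA : IsCoprime (x ^ 3 + 7 * y ^ 3) (3 * x * y))
    (h7 : IsCoprime (x ^ 3 + 7 * y ^ 3) 7) :
    IsCoprime ((x : 𝓞 K) + y * θ) ((x : 𝓞 K) ^ 2 - x * y * θ + y ^ 2 * θ ^ 2) := by
  have h3 := hθ.pow_three
  have hA' : IsCoprime ((x : 𝓞 K) ^ 3 + 7 * y ^ 3) (3 * (x : 𝓞 K) * y) := by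
    simpa using hA.map (Int.castRingHom (𝓞 K))
  have h7' : IsCoprime ((x : 𝓞 K) ^ 3 + 7 * y ^ 3) θ := by
    have := h7.map (Int.castRingHom (𝓞 K))
    rw [map_ofNat, ← h3] at this
    simpa using! (IsCoprime.pow_right_iff three_pos).1 this
  obtain ⟨u, v, huv⟩ := hA'.mul_right h7'
  refine ⟨u * (x ^ 2 - x * y * θ + y ^ 2 * θ ^ 2) + v * (x + y * θ), -v, ?_⟩
  linear_combination huv + u * y ^ 3 * h3

theorem not_pow_three_add_seven_mul_pow_three_eq {x y w P : ℤ} (hxy : IsCoprime x y)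
    (hP : P = 262193) (h : x ^ 3 + 7 * y ^ 3 = P ^ 4 * w ^ 7) : False := by
  have h3 := hθ.pow_three
  have h7x := not_seven_dvd_of_pow_three_add_eq hxy (by rw [hP]; norm_num) h
  have h3A := not_three_dvd_of_pow_three_add_eq hxy (by rw [hP]; norm_num) h
  have h7A := isCoprime_pow_three_add_seven (y := y) h7x
  have hA := isCoprime_pow_three_add_mul hxy h7x h3A
  have hcop := hθ.isCoprime_of_pow_three_add hA h7A
  have hn : IsCoprime (64 * (x : 𝓞 K) ^ 2 + 7 * x * y - 4096 * y ^ 2) (P : 𝓞 K) := by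
    simpa using (isCoprime_of_isCoprime_of_eq hxy hP).map (Int.castRingHom (𝓞 K))
  obtain ⟨u, v, huv⟩ := hn
  have h' : (x : 𝓞 K) ^ 3 + 7 * y ^ 3 = (P : 𝓞 K) ^ 4 * w ^ 7 := by exact_mod_cast h
  set ξ : 𝓞 K := x + y * θ with hξ
  set ξ' : 𝓞 K := x ^ 2 - x * y * θ + y ^ 2 * θ ^ 2 with hξ'
  set γ : 𝓞 K := 64 + θ ^ 2 with hγ
  set γ' : 𝓞 K := 4096 - 64 * θ ^ 2 + 7 * θ with hγ'
  have hγγ' : γ * γ' = P := by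
    rw [hγ, hγ', hP]
    push_cast
    linear_combination (7 - 64 * θ) * h3
  have hξξ' : ξ * ξ' = (γ * γ') ^ 4 * w ^ 7 := by
    rw [hγγ', ← h', hξ, hξ']
    linear_combination y ^ 3 * h3
  have cop1 : IsCoprime γ' ξ := by
    refine ⟨v * γ - u * y ^ 2, u * (7 * y + 64 * (x - y * θ)), ?_⟩
    rw [hξ]
    linear_combination huv + v * hγγ' - u * y ^ 2 * hγ'
  have cop2 : IsCoprime γ ξ' := by
    refine ⟨v * γ' + u * (x * y * θ - 64 * y ^ 2), 64 * u, ?_⟩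
    rw [hξ']
    linear_combination huv + v * hγγ' + u * (x * y * θ - 64 * y ^ 2) * hγ + u * x * y * h3
  obtain ⟨ξ₁, h1⟩ : γ ^ 4 ∣ ξ := cop2.pow_left.dvd_of_dvd_mul_right
    ⟨γ' ^ 4 * w ^ 7, by rw [hξξ']; ring⟩
  obtain ⟨ξ₂, h2⟩ : γ' ^ 4 ∣ ξ' := cop1.pow_left.dvd_of_dvd_mul_left
    ⟨γ ^ 4 * w ^ 7, by rw [hξξ']; ring⟩
  have hmul : ξ₁ * ξ₂ = w ^ 7 := by
    have h0 : (γ * γ') ^ 4 ≠ 0 := by rw [hγγ', hP]; norm_num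
    refine mul_left_cancel₀ h0 ?_
    rw [← hξξ', h1, h2]
    ring
  have hξ0 : ξ₁ ≠ 0 := by
    rintro rfl
    rw [mul_zero] at h1
    rw [h1, zero_mul, hγγ', ← h'] at hξξ'
    have : x ^ 3 + 7 * y ^ 3 = 0 := by exact_mod_cast hξξ'.symm
    exact h3A (this ▸ dvd_zero 3)
  have hcop' : IsCoprime (Ideal.span {ξ₁}) (Ideal.span {ξ₂}) :=
    (Ideal.isCoprime_span_singleton_iff ξ₁ ξ₂).2
      ((hcop.of_isCoprime_of_dvd_left ⟨_, h1.trans (mul_comm _ _)⟩).of_isCoprime_of_dvd_right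
        ⟨_, h2.trans (mul_comm _ _)⟩)
  obtain ⟨I, hI⟩ := exists_eq_pow_of_mul_eq_pow_of_coprime (c := Ideal.span {(w : 𝓞 K)}) hcop'
    (by rw [Ideal.span_singleton_mul_span_singleton, hmul, Ideal.span_singleton_pow])
  have hI0 : I ≠ ⊥ := by
    rintro rfl
    rw [← Ideal.zero_eq_bot, zero_pow (by norm_num), Ideal.zero_eq_bot,
      Ideal.span_singleton_eq_bot] at hI
    exact hξ0 hI
  obtain ⟨α, hα⟩ := hθ.isPrincipal_of_pow_seven hI0 ⟨ξ₁, hI.symm⟩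
  rw [hα, Ideal.submodule_span_eq, Ideal.span_singleton_pow,
    Ideal.span_singleton_eq_span_singleton] at hI
  obtain ⟨u, hu⟩ := hI.symm
  refine hθ.add_mul_ne_unit_mul (y := y) h7x u α ?_
  rw [← hξ, h1, ← hu]
  ring

end IsCbrtSeven

end PureCubic

theorem exists_isCbrtSeven : ∃ (K : Type) (_ : Field K) (_ : NumberField K) (θ : 𝓞 K),
    IsCbrtSeven θ := by
  have hirr := IsCbrtSeven.irreducible_X_pow_three_sub_seven
  have : Fact (Irreducible (Polynomial.X ^ 3 - Polynomial.C 7 : Polynomial ℚ)) := ⟨hirr⟩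
  let pb := AdjoinRoot.powerBasis hirr.ne_zero
  have : FiniteDimensional ℚ (AdjoinRoot (Polynomial.X ^ 3 - Polynomial.C 7 : Polynomial ℚ)) :=
    pb.finite
  have : CharZero (AdjoinRoot (Polynomial.X ^ 3 - Polynomial.C 7 : Polynomial ℚ)) :=
    charZero_of_injective_algebraMap (algebraMap ℚ _).injective
  have hroot : AdjoinRoot.root (Polynomial.X ^ 3 - Polynomial.C 7 : Polynomial ℚ) ^ 3 = 7 := by
    have := AdjoinRoot.eval₂_root (Polynomial.X ^ 3 - Polynomial.C 7 : Polynomial ℚ)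
    rw [Polynomial.eval₂_sub, Polynomial.eval₂_X_pow, Polynomial.eval₂_C, sub_eq_zero] at this
    exact this.trans (map_ofNat (AdjoinRoot.of _) 7)
  have hint : IsIntegral ℤ (AdjoinRoot.root (Polynomial.X ^ 3 - Polynomial.C 7 : Polynomial ℚ)) :=
    ⟨Polynomial.X ^ 3 - Polynomial.C 7, Polynomial.monic_X_pow_sub_C _ (by norm_num), by
      simp [hroot]⟩
  refine ⟨AdjoinRoot (Polynomial.X ^ 3 - Polynomial.C 7 : Polynomial ℚ), inferInstance, ⟨⟩,
    ⟨_, hint⟩, ⟨?_, ?_⟩⟩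
  · apply RingOfIntegers.ext
    simpa [map_ofNat (algebraMap (𝓞 _) _)] using! hroot
  · rw [pb.finrank, AdjoinRoot.powerBasis_dim, Polynomial.natDegree_X_pow_sub_C]

theorem isCoprime_pow_three_add_quadratic_mul {x y : ℤ} (hxy : IsCoprime x y) :
    IsCoprime (x ^ 3 + 7 * y ^ 3)
      ((x ^ 2 + 4 * x * y + 16 * y ^ 2) * (16 * x ^ 2 + 4 * x * y + y ^ 2)) := by
  have p71 : Prime (71 : ℤ) := by norm_num
  have p449 : Prime (449 : ℤ) := by norm_num
  refine IsCoprime.mul_right ?_ ?_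
  · have h71 : IsCoprime 71 (x ^ 2 + 4 * x * y + 16 * y ^ 2) := by
      rw [p71.coprime_iff_not_dvd]
      intro h
      obtain ⟨h1, h2⟩ := Int.dvd_of_dvd_sq_add_mul_add_sq (p := 71) (by norm_num) (by norm_num)
        (a := x) (b := 4 * y) (by convert! h using 1; ring)
      exact p71.not_isUnit
        (hxy.isUnit_of_dvd' h1 ((p71.dvd_or_dvd h2).resolve_left (by norm_num)))
    have hy : IsCoprime y (x ^ 2 + 4 * x * y + 16 * y ^ 2) := by
      rw [show x ^ 2 + 4 * x * y + 16 * y ^ 2 = x ^ 2 + y * (4 * x + 16 * y) by ring,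
        IsCoprime.add_mul_left_right_iff]
      exact hxy.symm.pow_right
    rw [show x ^ 3 + 7 * y ^ 3 = 71 * y ^ 3 + (x ^ 2 + 4 * x * y + 16 * y ^ 2) * (x - 4 * y) by ring,
      IsCoprime.add_mul_left_left_iff]
    exact h71.mul_left hy.pow_left
  · have h449 : IsCoprime 449 (16 * x ^ 2 + 4 * x * y + y ^ 2) := by
      rw [p449.coprime_iff_not_dvd]
      intro h
      obtain ⟨h1, h2⟩ := Int.dvd_of_dvd_sq_add_mul_add_sq (p := 449) (by norm_num) (by norm_num)
        (a := 4 * x) (b := y) (by convert! h using 1; ring)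
      exact p449.not_isUnit
        (hxy.isUnit_of_dvd' ((p449.dvd_or_dvd h1).resolve_left (by norm_num)) h2)
    have hx : IsCoprime x (16 * x ^ 2 + 4 * x * y + y ^ 2) := by
      rw [show 16 * x ^ 2 + 4 * x * y + y ^ 2 = y ^ 2 + x * (16 * x + 4 * y) by ring,
        IsCoprime.add_mul_left_right_iff]
      exact hxy.pow_right
    rw [show x ^ 3 + 7 * y ^ 3
        = 449 * x ^ 3 + (16 * x ^ 2 + 4 * x * y + y ^ 2) * (-7 * (4 * x - y)) by ring,
      IsCoprime.add_mul_left_left_iff]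
    exact h449.mul_left hx.pow_left

theorem isCoprime_262193_quadratic_mul {x y P : ℤ} (hxy : IsCoprime x y) (hP : P = 262193) :
    IsCoprime P ((x ^ 2 + 4 * x * y + 16 * y ^ 2) * (16 * x ^ 2 + 4 * x * y + y ^ 2)) := by
  have hprime : Prime P := by
    rw [hP]
    exact_mod_cast Nat.prime_iff_prime_int.1 prime_262193
  have hdvd {a b : ℤ} (h : P ∣ a ^ 2 + a * b + b ^ 2) : P ∣ a ∧ P ∣ b := by
    have := Int.dvd_of_dvd_sq_add_mul_add_sq (a := a) (b := b) prime_262193 (by norm_num)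
    push_cast at this
    rw [← hP] at this
    exact this h
  have h4 : ¬ P ∣ 4 := by
    rw [hP]
    norm_num
  rw [hprime.coprime_iff_not_dvd]
  intro h
  rcases hprime.dvd_or_dvd h with h | h
  · obtain ⟨h1, h2⟩ := hdvd (a := x) (b := 4 * y) (by convert! h using 1; ring)
    exact hprime.not_isUnit (hxy.isUnit_of_dvd' h1 ((hprime.dvd_or_dvd h2).resolve_left h4))
  · obtain ⟨h1, h2⟩ := hdvd (a := 4 * x) (b := y) (by convert! h using 1; ring)
    exact hprime.not_isUnit (hxy.isUnit_of_dvd' ((hprime.dvd_or_dvd h1).resolve_left h4) h2)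

theorem degree_seven_int_ne {x y z P : ℤ} (hxy : IsCoprime x y) (hP : P = 262193) :
    (x ^ 3 + 7 * y ^ 3) * ((x ^ 2 + 4 * x * y + 16 * y ^ 2) * (16 * x ^ 2 + 4 * x * y + y ^ 2))
      ≠ P ^ 4 * z ^ 7 := by
  intro h
  have hcop := isCoprime_pow_three_add_quadratic_mul hxy
  obtain ⟨A, hA⟩ := (isCoprime_262193_quadratic_mul hxy hP).pow_left.dvd_of_dvd_mul_right ⟨z ^ 7, h⟩
  have hP0 : P ^ 4 ≠ 0 := pow_ne_zero _ (by rw [hP]; norm_num)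
  have hmul : A * ((x ^ 2 + 4 * x * y + 16 * y ^ 2) * (16 * x ^ 2 + 4 * x * y + y ^ 2))
      = z ^ 7 := by
    refine mul_left_cancel₀ hP0 ?_
    rw [← h, hA]
    ring
  obtain ⟨w, rfl⟩ := Int.eq_pow_of_mul_eq_pow_odd_left
    (hcop.of_isCoprime_of_dvd_left ⟨_, hA.trans (mul_comm _ _)⟩) (by decide) hmul
  obtain ⟨K, _, _, θ, hθ⟩ := exists_isCbrtSeven
  exact hθ.not_pow_three_add_seven_mul_pow_three_eq hxy hP hA

theorem exists_isCoprime_int_mul {X Y : ℚ} (h : ¬ (X = 0 ∧ Y = 0)) :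
    ∃ (r : ℚ) (x y : ℤ), r ≠ 0 ∧ IsCoprime x y ∧ X = r * x ∧ Y = r * y := by
  have hX : (X.den : ℚ) ≠ 0 := by exact_mod_cast X.den_ne_zero
  have hY : (Y.den : ℚ) ≠ 0 := by exact_mod_cast Y.den_ne_zero
  have eX : X = X.num / X.den := (Rat.num_div_den X).symm
  have eY : Y = Y.num / Y.den := (Rat.num_div_den Y).symm
  have hab : ¬ (X.num * Y.den = 0 ∧ Y.num * X.den = 0) := by
    simpa using h
  obtain ⟨x, y, hg, hxy, ha, hb⟩ : ∃ x y : ℤ,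
      ((Int.gcd (X.num * Y.den) (Y.num * X.den) : ℤ) : ℚ) ≠ 0 ∧ IsCoprime x y ∧
        X.num * Y.den = Int.gcd (X.num * Y.den) (Y.num * X.den) * x ∧
        Y.num * X.den = Int.gcd (X.num * Y.den) (Y.num * X.den) * y := by
    have hpos : 0 < Int.gcd (X.num * Y.den) (Y.num * X.den) :=
      Nat.pos_of_ne_zero fun h0 => hab (Int.gcd_eq_zero_iff.1 h0)
    obtain ⟨x, y, h1, h2, h3⟩ := Int.exists_gcd_one hpos
    refine ⟨x, y, by exact_mod_cast hpos.ne', Int.isCoprime_iff_gcd_eq_one.2 h1,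
      by rw [mul_comm _ x]; exact h2, by rw [mul_comm _ y]; exact h3⟩
  generalize Int.gcd (X.num * Y.den) (Y.num * X.den) = g at *
  refine ⟨(g : ℤ) / (X.den * Y.den), x, y, div_ne_zero hg (mul_ne_zero hX hY), hxy, ?_, ?_⟩
  · have : (X.num * Y.den : ℚ) = (g : ℤ) * x := by exact_mod_cast ha
    rw [div_mul_eq_mul_div, ← this]
    field_simp
    rw [Rat.mul_den_eq_num]
  · have : (Y.num * X.den : ℚ) = (g : ℤ) * y := by exact_mod_cast hb
    rw [div_mul_eq_mul_div, ← this]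
    field_simp
    rw [Rat.mul_den_eq_num]

theorem exists_int_eq_mul_pow_seven {P f : ℤ} {z : ℚ} (hP : Prime P)
    (h : (f : ℚ) = P ^ 4 * z ^ 7) : ∃ m : ℤ, f = P ^ 4 * m ^ 7 := by
  have hint : IsIntegral ℤ (P * z) :=
    ⟨Polynomial.X ^ 7 - Polynomial.C (P ^ 3 * f), Polynomial.monic_X_pow_sub_C _ (by norm_num), by
      rw [Polynomial.eval₂_sub, Polynomial.eval₂_X_pow, Polynomial.eval₂_C, eq_intCast]
      push_cast
      rw [h]
      ring⟩
  obtain ⟨m, hm⟩ := IsIntegrallyClosed.isIntegral_iff.1 hint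
  have hm' : m ^ 7 = P ^ 3 * f := by
    rw [eq_intCast] at hm
    have : (m : ℚ) ^ 7 = P ^ 3 * f := by
      rw [hm, h]
      ring
    exact_mod_cast this
  obtain ⟨n, rfl⟩ := hP.dvd_of_dvd_pow (n := 7) (Dvd.intro (P ^ 2 * f) (by rw [hm']; ring))
  refine ⟨n, mul_left_cancel₀ (pow_ne_zero 3 hP.ne_zero) ?_⟩
  rw [← hm']
  ring

theorem degree_seven_rat_eq_zero {X Y Z : ℚ}
    (h : EqnHolds 7 (262193 ^ 4) 7 ![(1, 4), (4, 1)] X Y Z) : (X, Y, Z) = (0, 0, 0) := by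
  rw [eqnHolds_degree_seven_iff] at h
  obtain ⟨P, hP⟩ : ∃ P : ℤ, P = 262193 := ⟨_, rfl⟩
  have hprime : Prime P := by
    rw [hP]
    exact_mod_cast Nat.prime_iff_prime_int.1 prime_262193
  have hPQ : (262193 : ℚ) = P := by
    rw [hP]
    norm_num
  rw [hPQ] at h
  by_cases h0 : X = 0 ∧ Y = 0
  · obtain ⟨rfl, rfl⟩ := h0
    have hP0 : (P : ℚ) ^ 4 ≠ 0 := pow_ne_zero _ (by exact_mod_cast hprime.ne_zero)
    have : Z ^ 7 = 0 := by
      refine (mul_eq_zero.1 (Eq.trans h.symm ?_)).resolve_left hP0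
      ring
    rw [pow_eq_zero_iff (by norm_num)] at this
    rw [this]
  · exfalso
    obtain ⟨r, x, y, hr, hxy, rfl, rfl⟩ := exists_isCoprime_int_mul h0
    obtain ⟨z, hz⟩ := exists_int_eq_mul_pow_seven (z := Z / r) (f := (x ^ 3 + 7 * y ^ 3) *
      ((x ^ 2 + 4 * x * y + 16 * y ^ 2) * (16 * x ^ 2 + 4 * x * y + y ^ 2))) hprime (by
        push_cast
        rw [div_pow, mul_div_assoc', eq_div_iff (pow_ne_zero 7 hr), ← h]
        ring)
    exact degree_seven_int_ne hxy hP hz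

/-- The degree-7 example: `(X³+7Y³)(X²+4XY+16Y²)(16X²+4XY+Y²) = 262193⁴ Z⁷` defines a
non-singular plane projective curve of degree 7 which violates the local-global
principle. -/
theorem degree_seven_example :
    ViolatesLGP 7 (262193 ^ 4) 7 ![(1, 4), (4, 1)] ∧
    (curvePoly 7 (262193 ^ 4) 7 ![(1, 4), (4, 1)]).totalDegree = 7 ∧
    IsNonsingular (curvePoly 7 (262193 ^ 4) 7 ![(1, 4), (4, 1)]) :=
  ⟨⟨exists_real_solution, fun l _ => exists_padic_solution l,
    fun _ _ _ h => degree_seven_rat_eq_zero h⟩,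
    curvePoly_degree_seven_totalDegree, curvePoly_degree_seven_isNonsingular⟩
end

section
/- The equation (X³ + 9Y³)(X² + 2XY + 4Y²)(4X² − 10XY + 25Y²)(4X² − 2XY + Y²) = 431² · Z⁹ defines a non-singular plane projective curve of degree 9, has solutions other than (0,0,0) over ℝ and over ℚ_l for every prime l, but has no solution in rational numbers other than (0,0,0); that is, it violates the local-global principle. -/
open MvPolynomial

lemma ZMod.cube_injective {p : ℕ} [Fact p.Prime] (hp : p % 3 = 2) :
    Function.Injective fun t : ZMod p => t ^ 3 := by
  refine Function.LeftInverse.injective (g := fun t => t ^ (2 * (p / 3) + 1)) fun t => ?_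
  have h1 : t ^ p = t := ZMod.pow_card t
  calc (t ^ 3) ^ (2 * (p / 3) + 1) = t ^ p * t ^ (p - 1) := by
        rw [← pow_mul, ← pow_add]; congr 1; omega
    _ = t * t ^ (p - 1) := by rw [h1]
    _ = t ^ p := by rw [← pow_succ']; congr 1; omega
    _ = t := h1

/-- The ring `ℤ[λ]` with `λ ^ 3 = 3`; the triple `(a, b, c)` stands for `a + b λ + c λ ^ 2`. -/
@[ext]
structure CbrtThree where
  a : ℤ
  b : ℤ
  c : ℤ

namespace CbrtThree

instance : Zero CbrtThree := ⟨⟨0, 0, 0⟩⟩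
instance : One CbrtThree := ⟨⟨1, 0, 0⟩⟩
instance : Add CbrtThree := ⟨fun x y => ⟨x.a + y.a, x.b + y.b, x.c + y.c⟩⟩
instance : Neg CbrtThree := ⟨fun x => ⟨-x.a, -x.b, -x.c⟩⟩
instance : Mul CbrtThree := ⟨fun x y =>
  ⟨x.a * y.a + 3 * (x.b * y.c + x.c * y.b), x.a * y.b + x.b * y.a + 3 * (x.c * y.c),
    x.a * y.c + x.b * y.b + x.c * y.a⟩⟩

@[simp] lemma zero_a : (0 : CbrtThree).a = 0 := rfl
@[simp] lemma zero_b : (0 : CbrtThree).b = 0 := rfl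
@[simp] lemma zero_c : (0 : CbrtThree).c = 0 := rfl
@[simp] lemma one_a : (1 : CbrtThree).a = 1 := rfl
@[simp] lemma one_b : (1 : CbrtThree).b = 0 := rfl
@[simp] lemma one_c : (1 : CbrtThree).c = 0 := rfl
@[simp] lemma add_a (x y : CbrtThree) : (x + y).a = x.a + y.a := rfl
@[simp] lemma add_b (x y : CbrtThree) : (x + y).b = x.b + y.b := rfl
@[simp] lemma add_c (x y : CbrtThree) : (x + y).c = x.c + y.c := rfl
@[simp] lemma neg_a (x : CbrtThree) : (-x).a = -x.a := rfl
@[simp] lemma neg_b (x : CbrtThree) : (-x).b = -x.b := rfl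
@[simp] lemma neg_c (x : CbrtThree) : (-x).c = -x.c := rfl
@[simp] lemma mul_a (x y : CbrtThree) :
    (x * y).a = x.a * y.a + 3 * (x.b * y.c + x.c * y.b) := rfl
@[simp] lemma mul_b (x y : CbrtThree) :
    (x * y).b = x.a * y.b + x.b * y.a + 3 * (x.c * y.c) := rfl
@[simp] lemma mul_c (x y : CbrtThree) :
    (x * y).c = x.a * y.c + x.b * y.b + x.c * y.a := rfl

instance : CommRing CbrtThree :=
  CommRing.ofMinimalAxioms
    (fun x y z => by ext <;> simp <;> ring)
    (fun x => by ext <;> simp)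
    (fun x => by ext <;> simp)
    (fun x y z => by ext <;> simp <;> ring)
    (fun x y => by ext <;> simp <;> ring)
    (fun x => by ext <;> simp)
    (fun x y z => by ext <;> simp <;> ring)

@[simp] lemma sub_a (x y : CbrtThree) : (x - y).a = x.a - y.a := by
  rw [sub_eq_add_neg, add_a, neg_a, ← sub_eq_add_neg]
@[simp] lemma sub_b (x y : CbrtThree) : (x - y).b = x.b - y.b := by
  rw [sub_eq_add_neg, add_b, neg_b, ← sub_eq_add_neg]
@[simp] lemma sub_c (x y : CbrtThree) : (x - y).c = x.c - y.c := by
  rw [sub_eq_add_neg, add_c, neg_c, ← sub_eq_add_neg]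

/-- The inclusion of `ℤ`. -/
def ofInt : ℤ →+* CbrtThree where
  toFun n := ⟨n, 0, 0⟩
  map_zero' := rfl
  map_one' := rfl
  map_add' m n := by ext <;> simp
  map_mul' m n := by ext <;> simp

lemma intCast_eq (n : ℤ) : (n : CbrtThree) = ⟨n, 0, 0⟩ := (eq_intCast ofInt n).symm

@[simp] lemma intCast_a (n : ℤ) : (n : CbrtThree).a = n := by rw [intCast_eq]
@[simp] lemma intCast_b (n : ℤ) : (n : CbrtThree).b = 0 := by rw [intCast_eq]
@[simp] lemma intCast_c (n : ℤ) : (n : CbrtThree).c = 0 := by rw [intCast_eq]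

instance : Nontrivial CbrtThree := ⟨0, 1, fun h => by simpa using congrArg a h⟩

/-- The norm form. -/
def norm (x : CbrtThree) : ℤ := x.a ^ 3 + 3 * x.b ^ 3 + 9 * x.c ^ 3 - 9 * x.a * x.b * x.c

/-- The product of the two other conjugates. -/
def adj (x : CbrtThree) : CbrtThree :=
  ⟨x.a ^ 2 - 3 * x.b * x.c, 3 * x.c ^ 2 - x.a * x.b, x.b ^ 2 - x.a * x.c⟩

lemma mul_adj (x : CbrtThree) : x * adj x = (norm x : CbrtThree) := by
  rw [intCast_eq]
  ext <;> simp [adj, norm] <;> ring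

lemma norm_mul (x y : CbrtThree) : norm (x * y) = norm x * norm y := by
  simp only [norm, mul_a, mul_b, mul_c]; ring

lemma norm_one : norm 1 = 1 := by simp [norm]

lemma norm_adj (x : CbrtThree) : norm (adj x) = norm x ^ 2 := by
  simp only [norm, adj]; ring

lemma norm_pow (x : CbrtThree) (n : ℕ) : norm (x ^ n) = norm x ^ n := by
  induction n with
  | zero => simp [norm_one]
  | succ n ih => rw [pow_succ, norm_mul, ih, pow_succ]

lemma three_dvd_of_norm_form_eq_zero {x y z : ℤ}
    (h : x ^ 3 + 3 * y ^ 3 + 9 * z ^ 3 - 9 * x * y * z = 0) : (3 : ℤ) ∣ x :=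
  Int.prime_three.dvd_of_dvd_pow (n := 3)
    ⟨-(y ^ 3 + 3 * z ^ 3 - 3 * x * y * z), by linear_combination h⟩

lemma three_pow_dvd_of_norm_eq_zero {x : CbrtThree} (h : norm x = 0) (n : ℕ) :
    (3 : ℤ) ^ n ∣ x.a ∧ (3 : ℤ) ^ n ∣ x.b ∧ (3 : ℤ) ^ n ∣ x.c := by
  induction n generalizing x with
  | zero => simp
  | succ n ih =>
    obtain ⟨x, y, z⟩ := x
    simp only [norm] at h
    obtain ⟨x, rfl⟩ := three_dvd_of_norm_form_eq_zero h
    have h₁ : y ^ 3 + 3 * z ^ 3 + 9 * x ^ 3 - 9 * y * z * x = 0 := by linarith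
    obtain ⟨y, rfl⟩ := three_dvd_of_norm_form_eq_zero h₁
    have h₂ : z ^ 3 + 3 * x ^ 3 + 9 * y ^ 3 - 9 * z * x * y = 0 := by linarith
    obtain ⟨z, rfl⟩ := three_dvd_of_norm_form_eq_zero h₂
    obtain ⟨h₃, h₄, h₅⟩ := ih (x := ⟨x, y, z⟩) (by simp only [norm]; linarith)
    simp only [pow_succ']
    exact ⟨mul_dvd_mul_left 3 h₃, mul_dvd_mul_left 3 h₄, mul_dvd_mul_left 3 h₅⟩

lemma eq_zero_of_three_pow_dvd {x : ℤ} (h : ∀ n : ℕ, (3 : ℤ) ^ n ∣ x) : x = 0 := by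
  refine Int.eq_zero_of_abs_lt_dvd (h x.natAbs) ?_
  rw [Int.abs_eq_natAbs]
  exact_mod_cast Nat.lt_pow_self (by norm_num : 1 < 3)

lemma norm_eq_zero {x : CbrtThree} : norm x = 0 ↔ x = 0 := by
  refine ⟨fun h => ?_, fun h => by simp [h, norm]⟩
  have := three_pow_dvd_of_norm_eq_zero h
  ext
  · exact eq_zero_of_three_pow_dvd fun n => (this n).1
  · exact eq_zero_of_three_pow_dvd fun n => (this n).2.1
  · exact eq_zero_of_three_pow_dvd fun n => (this n).2.2

lemma isUnit_iff {x : CbrtThree} : IsUnit x ↔ IsUnit (norm x) := by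
  refine ⟨fun h => ?_, fun h => ?_⟩
  · obtain ⟨y, hy⟩ := h.exists_right_inv
    exact .of_mul_eq_one (norm y) (by rw [← norm_mul, hy, norm_one])
  · refine isUnit_of_dvd_unit ⟨adj x, (mul_adj x).symm⟩ ?_
    simpa using h.map (Int.castRingHom CbrtThree)

/-- An upper bound for `8 * 20 ^ 3 * |N|` on a cube of side `1 / 20` whose centre is
`(P, Q, R) / 40`, where `N` is the norm form. -/
def cellBound (P Q R : ℤ) : ℤ :=
  |P ^ 3 + 3 * Q ^ 3 + 9 * R ^ 3 - 9 * P * Q * R| + |3 * P ^ 2 - 9 * Q * R| +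
    |9 * Q ^ 2 - 9 * P * R| + |27 * R ^ 2 - 9 * P * Q| + 12 * |P| + 18 * |Q| + 36 * |R| + 22

/-- Translation vectors that suffice to move any point of the unit cube to a point of norm less
than `1`. -/
def shifts : List (ℤ × ℤ × ℤ) :=
  [(0, 0, 0), (0, 0, 1), (0, 1, 0), (0, 1, 1), (1, 0, 0), (1, 0, 1), (1, 1, 0), (1, 1, 1),
    (-1, -1, -1), (-1, -1, 0), (-1, 0, 0), (-1, 0, 1), (-1, 1, 0), (-1, 1, 1), (-1, 2, 0),
    (-1, 2, 1), (0, -1, 0), (0, -1, 1), (0, 2, 0), (1, -1, 1), (2, 1, 0), (2, 1, 1), (2, 2, 1)]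

lemma exists_shift_cellBound_lt : ∀ p < 20, ∀ q < 20, ∀ r < 20,
    ∃ s ∈ shifts, cellBound (2 * (p : ℕ) + 1 - 40 * s.1) (2 * (q : ℕ) + 1 - 40 * s.2.1)
      (2 * (r : ℕ) + 1 - 40 * s.2.2) < 64000 := by
  decide +kernel

lemma abs_norm_form_le_cellBound (P Q R : ℤ) {e f g : ℚ} (he : |e| ≤ 1) (hf : |f| ≤ 1)
    (hg : |g| ≤ 1) :
    |((P + e) ^ 3 + 3 * (Q + f) ^ 3 + 9 * (R + g) ^ 3 - 9 * (P + e) * (Q + f) * (R + g) : ℚ)| ≤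
      (cellBound P Q R : ℚ) := by
  have bd : ∀ (s t : ℚ), |t| ≤ 1 → |s * t| ≤ |s| := fun s t ht => by
    rw [abs_mul]; exact mul_le_of_le_one_right (abs_nonneg _) ht
  have mul1 : ∀ {s t : ℚ}, |s| ≤ 1 → |t| ≤ 1 → |s * t| ≤ 1 := fun hs ht => by
    rw [abs_mul]; exact mul_le_one₀ hs (abs_nonneg _) ht
  have expand : ((P + e) ^ 3 + 3 * (Q + f) ^ 3 + 9 * (R + g) ^ 3
      - 9 * (P + e) * (Q + f) * (R + g) : ℚ) =
      (P ^ 3 + 3 * Q ^ 3 + 9 * R ^ 3 - 9 * P * Q * R) + (3 * P ^ 2 - 9 * Q * R) * e +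
      (9 * Q ^ 2 - 9 * P * R) * f + (27 * R ^ 2 - 9 * P * Q) * g +
      (3 * (P * (e * e)) - 9 * (P * (f * g)) + 9 * (Q * (f * f)) - 9 * (Q * (e * g))
        + 27 * (R * (g * g)) - 9 * (R * (e * f))
        + (e * e * e) + 3 * (f * f * f) + 9 * (g * g * g) - 9 * (e * f * g)) := by ring
  rw [expand, cellBound]
  push_cast
  have h1 := abs_le.1 (bd (3 * P ^ 2 - 9 * Q * R) e he)
  have h2 := abs_le.1 (bd (9 * Q ^ 2 - 9 * P * R) f hf)
  have h3 := abs_le.1 (bd (27 * R ^ 2 - 9 * P * Q) g hg)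
  have h4 := abs_le.1 (bd P _ (mul1 he he))
  have h5 := abs_le.1 (bd P _ (mul1 hf hg))
  have h6 := abs_le.1 (bd Q _ (mul1 hf hf))
  have h7 := abs_le.1 (bd Q _ (mul1 he hg))
  have h8 := abs_le.1 (bd R _ (mul1 hg hg))
  have h9 := abs_le.1 (bd R _ (mul1 he hf))
  have h10 := abs_le.1 (mul1 (mul1 he he) he)
  have h11 := abs_le.1 (mul1 (mul1 hf hf) hf)
  have h12 := abs_le.1 (mul1 (mul1 hg hg) hg)
  have h13 := abs_le.1 (mul1 (mul1 he hf) hg)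
  have h14 := abs_le.1 (le_refl |(P ^ 3 + 3 * Q ^ 3 + 9 * R ^ 3 - 9 * P * Q * R : ℚ)|)
  rw [abs_le]
  constructor <;> linarith

lemma exists_cell (x : ℚ) : ∃ (i : ℤ) (p : ℕ) (e : ℚ), p < 20 ∧ |e| ≤ 1 ∧
    x = i + (2 * p + 1 + e) / 40 := by
  have h0 := Int.emod_nonneg ⌊20 * x⌋ (by norm_num : (20 : ℤ) ≠ 0)
  refine ⟨⌊20 * x⌋ / 20, (⌊20 * x⌋ % 20).toNat, 40 * x - 2 * ⌊20 * x⌋ - 1, by omega, ?_, ?_⟩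
  · have h1 := Int.floor_le (20 * x)
    have h2 := Int.lt_floor_add_one (20 * x)
    rw [abs_le]
    constructor <;> linarith
  · have h1 : (((⌊20 * x⌋ % 20).toNat : ℤ) : ℚ) = ((⌊20 * x⌋ % 20 : ℤ) : ℚ) := by
      rw [Int.toNat_of_nonneg h0]
    have h2 : (((20 * (⌊20 * x⌋ / 20) + ⌊20 * x⌋ % 20 : ℤ)) : ℚ) = ((⌊20 * x⌋ : ℤ) : ℚ) := by
      rw [Int.mul_ediv_add_emod]
    push_cast at h1 h2
    rw [h1]
    linarith

lemma exists_abs_norm_form_sub_lt_one (x y z : ℚ) : ∃ i j k : ℤ,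
    |(x - i) ^ 3 + 3 * (y - j) ^ 3 + 9 * (z - k) ^ 3 - 9 * (x - i) * (y - j) * (z - k)| < 1 := by
  obtain ⟨i, p, e, hp, he, rfl⟩ := exists_cell x
  obtain ⟨j, q, f, hq, hf, rfl⟩ := exists_cell y
  obtain ⟨k, r, g, hr, hg, rfl⟩ := exists_cell z
  obtain ⟨s, -, hs⟩ := exists_shift_cellBound_lt p hp q hq r hr
  refine ⟨i + s.1, j + s.2.1, k + s.2.2, ?_⟩
  have h := (abs_norm_form_le_cellBound _ _ _ he hf hg).trans_lt (Int.cast_lt.2 hs)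
  push_cast at h ⊢
  rw [abs_lt] at h ⊢
  constructor <;> linarith [h.1, h.2]

lemma exists_natAbs_norm_sub_mul_lt (x : CbrtThree) {y : CbrtThree} (hy : y ≠ 0) :
    ∃ z, (norm (x - y * z)).natAbs < (norm y).natAbs := by
  have hn : norm y ≠ 0 := norm_eq_zero.not.2 hy
  have hnq : (norm y : ℚ) ≠ 0 := by exact_mod_cast hn
  set w := x * adj y with hw
  obtain ⟨i, j, k, h⟩ := exists_abs_norm_form_sub_lt_one
    (w.a / norm y) (w.b / norm y) (w.c / norm y)
  refine ⟨⟨i, j, k⟩, ?_⟩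
  have key : norm (x - y * ⟨i, j, k⟩) * norm y ^ 2 =
      norm (w - (norm y : CbrtThree) * ⟨i, j, k⟩) := by
    rw [← norm_adj, ← norm_mul, hw, ← mul_adj]
    congr 1
    ring
  have h2 : (norm (x - y * ⟨i, j, k⟩) : ℚ) = norm y *
      ((w.a / norm y - i) ^ 3 + 3 * (w.b / norm y - j) ^ 3 + 9 * (w.c / norm y - k) ^ 3
        - 9 * (w.a / norm y - i) * (w.b / norm y - j) * (w.c / norm y - k)) := by
    have key' : (norm (x - y * ⟨i, j, k⟩) : ℚ) * norm y ^ 2 =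
        (w.a - norm y * i) ^ 3 + 3 * (w.b - norm y * j) ^ 3 + 9 * (w.c - norm y * k) ^ 3
        - 9 * (w.a - norm y * i) * (w.b - norm y * j) * (w.c - norm y * k) := by
      have := congrArg (Int.cast : ℤ → ℚ) key
      rw [norm.eq_1 (w - _)] at this
      simp at this
      linarith
    field_simp
    linarith
  have h3 : |(norm (x - y * ⟨i, j, k⟩) : ℚ)| < |(norm y : ℚ)| := by
    rw [h2, abs_mul]
    exact mul_lt_of_lt_one_right (abs_pos.2 hnq) h
  have h4 : |norm (x - y * ⟨i, j, k⟩)| < |norm y| := by exact_mod_cast h3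
  rw [Int.abs_eq_natAbs, Int.abs_eq_natAbs] at h4
  exact_mod_cast h4

open Classical in
noncomputable instance : EuclideanDomain CbrtThree where
  quotient x y := if h : y = 0 then 0 else (exists_natAbs_norm_sub_mul_lt x h).choose
  quotient_zero x := by simp
  remainder x y := x - y * (if h : y = 0 then 0 else (exists_natAbs_norm_sub_mul_lt x h).choose)
  quotient_mul_add_remainder_eq x y := by ring
  r x y := (norm x).natAbs < (norm y).natAbs
  r_wellFounded := (measure fun x => (norm x).natAbs).wf
  remainder_lt x y hy := by
    simp only [hy, dite_false]
    exact (exists_natAbs_norm_sub_mul_lt x hy).choose_spec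
  mul_left_not_lt x y hy := by
    rw [norm_mul, Int.natAbs_mul, not_lt]
    exact Nat.le_mul_of_pos_right _ (Int.natAbs_pos.2 (norm_eq_zero.not.2 hy))

end CbrtThree

namespace CbrtThree

/-- The real cube root of `3`. -/
noncomputable def root : ℝ := 3 ^ ((1 : ℝ) / 3)

lemma root_pow_three : root ^ 3 = 3 := by
  rw [root, ← Real.rpow_natCast, ← Real.rpow_mul (by norm_num)]
  norm_num

lemma lt_root : (1.44 : ℝ) < root :=
  lt_of_pow_lt_pow_left₀ 3 (by unfold root; positivity) (by rw [root_pow_three]; norm_num)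

lemma root_lt : root < (1.443 : ℝ) :=
  lt_of_pow_lt_pow_left₀ 3 (by norm_num) (by rw [root_pow_three]; norm_num)

/-- The real embedding. -/
noncomputable def toReal : CbrtThree →+* ℝ where
  toFun x := x.a + x.b * root + x.c * root ^ 2
  map_zero' := by simp
  map_one' := by simp
  map_add' x y := by simp; ring
  map_mul' x y := by
    have := root_pow_three
    simp
    linear_combination (-(x.b : ℝ) * y.c - x.c * y.b - root * x.c * y.c) * this

lemma toReal_apply (x : CbrtThree) : toReal x = x.a + x.b * root + x.c * root ^ 2 := rfl

lemma toReal_mul_eq_norm (x : CbrtThree) :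
    toReal x * ((x.a - x.b * root) ^ 2 + (x.b * root - x.c * root ^ 2) ^ 2
      + (x.a - x.c * root ^ 2) ^ 2) = 2 * norm x := by
  have := root_pow_three
  rw [toReal_apply, norm]
  push_cast
  linear_combination (2 * (x.b : ℝ) ^ 3 + 2 * x.c ^ 3 * (root ^ 3 + 3)
    - 6 * x.a * x.b * x.c) * this

/-- The fundamental unit `4 + 3 λ + 2 λ ^ 2`. -/
def fundUnit : CbrtThreeˣ where
  val := ⟨4, 3, 2⟩
  inv := ⟨-2, 0, 1⟩
  val_inv := by ext <;> simp
  inv_val := by ext <;> simp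

lemma toReal_fundUnit : toReal (fundUnit : CbrtThree) = 4 + 3 * root + 2 * root ^ 2 := by
  simp [toReal_apply, fundUnit]

lemma eq_one_of_norm_eq_one {x : CbrtThree} (hx : norm x = 1) (h₁ : 1 ≤ toReal x)
    (h₂ : toReal x < toReal (fundUnit : CbrtThree)) : x = 1 := by
  have hr := lt_root
  have hr' := root_lt
  have hr2 : (2.07 : ℝ) < root ^ 2 := by nlinarith
  have hr2' : root ^ 2 < (2.083 : ℝ) := by nlinarith
  have h := toReal_mul_eq_norm x
  rw [hx] at h
  have h₂' := h₂
  rw [toReal_fundUnit] at h₂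
  set p : ℝ := ((x.a : ℤ) : ℝ) with hp
  set q : ℝ := x.b * root with hq
  set r : ℝ := x.c * root ^ 2 with hr0
  have hs : toReal x = p + q + r := rfl
  have hdiff : (p - q) ^ 2 + (q - r) ^ 2 + (p - r) ^ 2 ≤ 2 := by
    push_cast at h
    nlinarith [sq_nonneg (p - q), sq_nonneg (q - r), sq_nonneg (p - r)]
  have d1 := abs_le.1 (abs_le_of_sq_le_sq (a := p - q) (b := 1.5)
    (by nlinarith [sq_nonneg (q - r), sq_nonneg (p - r)]) (by norm_num))
  have d2 := abs_le.1 (abs_le_of_sq_le_sq (a := q - r) (b := 1.5)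
    (by nlinarith [sq_nonneg (p - q), sq_nonneg (p - r)]) (by norm_num))
  have d3 := abs_le.1 (abs_le_of_sq_le_sq (a := p - r) (b := 1.5)
    (by nlinarith [sq_nonneg (p - q), sq_nonneg (q - r)]) (by norm_num))
  have ha1 : (-1 : ℝ) < x.a := by linarith
  have ha2 : (x.a : ℝ) < 6 := by linarith
  have hb1 : (-1 : ℝ) < x.b := by nlinarith
  have hb2 : (x.b : ℝ) < 4 := by nlinarith
  have hc1 : (-1 : ℝ) < x.c := by nlinarith
  have hc2 : (x.c : ℝ) < 3 := by nlinarith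
  replace ha1 : -1 < x.a := by exact_mod_cast ha1
  replace ha2 : x.a < 6 := by exact_mod_cast ha2
  replace hb1 : -1 < x.b := by exact_mod_cast hb1
  replace hb2 : x.b < 4 := by exact_mod_cast hb2
  replace hc1 : -1 < x.c := by exact_mod_cast hc1
  replace hc2 : x.c < 3 := by exact_mod_cast hc2
  clear h h₁ h₂ hs hdiff d1 d2 d3
  clear_value p q r
  clear hp hq hr0
  obtain ⟨a, b, c⟩ := x
  simp only [norm] at *
  interval_cases c <;> interval_cases b <;> interval_cases a <;>
    first | rfl | (norm_num at hx; done) | exact absurd h₂' (lt_irrefl _)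

lemma exists_eq_fundUnit_zpow (u : CbrtThreeˣ) (hu : norm u = 1) :
    ∃ k : ℤ, u = fundUnit ^ k := by
  have hr := lt_root
  have hpos : 0 < toReal (u : CbrtThree) := by
    have h := toReal_mul_eq_norm u
    rw [hu] at h
    refine pos_of_mul_pos_left (lt_of_lt_of_eq ?_ h.symm) (by positivity)
    norm_num
  have hη : 1 < toReal (fundUnit : CbrtThree) := by
    rw [toReal_fundUnit]; nlinarith
  obtain ⟨k, hk1, hk2⟩ := exists_mem_Ico_zpow hpos hη
  refine ⟨k, ?_⟩
  have hval : ∀ j : ℤ, toReal ((fundUnit ^ j : CbrtThreeˣ) : CbrtThree) =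
      toReal (fundUnit : CbrtThree) ^ j := fun j => by
    have h0 := congrArg Units.val (map_zpow (Units.map (toReal : CbrtThree →* ℝ)) fundUnit j)
    rw [Units.val_zpow_eq_zpow_val] at h0
    exact h0
  have hnorm : ∀ j : ℤ, norm ((fundUnit ^ j : CbrtThreeˣ) : CbrtThree) = 1 := fun j => by
    have h0 : norm (fundUnit : CbrtThree) = 1 := by simp [norm, fundUnit]
    let f : CbrtThree →* ℤ := ⟨⟨norm, norm_one⟩, norm_mul⟩
    have h1 : Units.map f fundUnit = 1 := Units.ext h0
    have h2 := congrArg Units.val (map_zpow (Units.map f) fundUnit j)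
    rw [h1, one_zpow] at h2
    exact h2
  have hpk : 0 < toReal (fundUnit : CbrtThree) ^ k := zpow_pos (by linarith) k
  have hprod : toReal ((u * fundUnit ^ (-k) : CbrtThreeˣ) : CbrtThree) =
      toReal (u : CbrtThree) / toReal (fundUnit : CbrtThree) ^ k := by
    rw [Units.val_mul, map_mul, hval, zpow_neg, div_eq_mul_inv]
  have h1 : u * fundUnit ^ (-k) = 1 := by
    refine Units.ext (eq_one_of_norm_eq_one ?_ ?_ ?_)
    · rw [Units.val_mul, norm_mul, hu, hnorm, one_mul]
    · rw [hprod, le_div_iff₀ hpk, one_mul]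
      exact hk1
    · rw [hprod, div_lt_iff₀ hpk]
      rw [zpow_add_one₀ (by linarith)] at hk2
      linarith
  rwa [zpow_neg, mul_inv_eq_one] at h1

lemma exists_eq_fundUnit_pow_mul_cube (u : CbrtThreeˣ) :
    ∃ (r : ℕ) (v : CbrtThreeˣ), r < 3 ∧ u = fundUnit ^ r * v ^ 3 := by
  wlog hu : norm u = 1 generalizing u
  · obtain ⟨r, v, hr, h⟩ := this (-u) (by
      have hneg : norm ((-u : CbrtThreeˣ) : CbrtThree) = -norm (u : CbrtThree) := by
        simp [norm]; ring
      rcases Int.isUnit_iff.1 (isUnit_iff.1 u.isUnit) with h | h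
      · exact absurd h hu
      · rw [hneg, h, neg_neg])
    refine ⟨r, -v, hr, ?_⟩
    rw [Odd.neg_pow (by decide), mul_neg, ← h, neg_neg]
  obtain ⟨k, rfl⟩ := exists_eq_fundUnit_zpow u hu
  have h0 := Int.emod_nonneg k (by norm_num : (3 : ℤ) ≠ 0)
  refine ⟨(k % 3).toNat, fundUnit ^ (k / 3), by omega, ?_⟩
  rw [← zpow_natCast, ← zpow_natCast, ← zpow_mul, ← zpow_add, Int.toNat_of_nonneg h0]
  congr 1
  push_cast
  omega

end CbrtThree

namespace CbrtThree

lemma three_dvd_b_of_isUnit {u : CbrtThree} (hu : IsUnit u) : 3 ∣ u.b := by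
  have h := Int.isUnit_iff.1 (isUnit_iff.1 hu)
  rw [norm] at h
  have h9 : ∀ x y z : ZMod 9, x ^ 3 + 3 * y ^ 3 + 9 * z ^ 3 - 9 * x * y * z = 1 ∨
      x ^ 3 + 3 * y ^ 3 + 9 * z ^ 3 - 9 * x * y * z = -1 → 3 * y = 0 := by decide +kernel
  have h3 : ((3 * u.b : ℤ) : ZMod 9) = 0 := by
    push_cast
    refine h9 u.a u.b u.c (h.imp (fun h => ?_) (fun h => ?_)) <;>
    simpa using congrArg (Int.cast : ℤ → ZMod 9) h
  rw [ZMod.intCast_zmod_eq_zero_iff_dvd] at h3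
  omega

lemma three_dvd_b_pow_three (x : CbrtThree) : 3 ∣ (x ^ 3).b := by
  refine ⟨x.a ^ 2 * x.b + 3 * x.a * x.c ^ 2 + 3 * x.b ^ 2 * x.c, ?_⟩
  simp only [pow_succ, pow_zero, one_mul, mul_a, mul_b, mul_c]
  ring

lemma three_dvd_b_mul {x y : CbrtThree} (hx : 3 ∣ x.b) (hy : 3 ∣ y.b) : 3 ∣ (x * y).b := by
  rw [mul_b]
  exact ((hy.mul_left _).add (hx.mul_right _)).add (dvd_mul_right _ _)

lemma pow_three_eq_of_three_dvd_b {s : CbrtThree} (hs : 3 ∣ s.b) :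
    ∃ A B C : ℤ, s ^ 3 = ⟨A, 9 * B, 3 * C⟩ := by
  obtain ⟨k, hk⟩ := hs
  refine ⟨(s ^ 3).a, s.a ^ 2 * k + s.a * s.c ^ 2 + s.b ^ 2 * s.c,
    s.a ^ 2 * s.c + s.a * s.b ^ 2 + 3 * s.b * s.c ^ 2, ?_⟩
  ext
  · rfl
  · simp only [pow_succ, pow_zero, one_mul, mul_a, mul_b, mul_c, hk]
    ring
  · simp only [pow_succ, pow_zero, one_mul, mul_a, mul_b, mul_c]
    ring

/-- A prime element of norm `431`. -/
def piElt : CbrtThree := ⟨8, -3, 0⟩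

lemma norm_piElt : norm piElt = 431 := by simp [norm, piElt]

lemma ne_unit_mul_piElt_sq_mul_pow_nine {x y : ℤ} (hx : ¬ 3 ∣ x) (hy : 3 ∣ y)
    {u v : CbrtThree} (hu : IsUnit u) :
    (⟨x, 0, y⟩ : CbrtThree) ≠ u * piElt ^ 2 * v ^ 9 := by
  intro h
  obtain ⟨u, rfl⟩ := hu
  obtain ⟨r, w, hr, rfl⟩ := exists_eq_fundUnit_pow_mul_cube u
  obtain ⟨A, B, C, hs⟩ := pow_three_eq_of_three_dvd_b
    (three_dvd_b_mul (three_dvd_b_of_isUnit w.isUnit) (three_dvd_b_pow_three v))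
  have h' : (⟨x, 0, y⟩ : CbrtThree) = fundUnit ^ r * piElt ^ 2 * ⟨A, 9 * B, 3 * C⟩ := by
    rw [h, ← hs]
    push_cast
    ring
  have e1 := congrArg a h'
  have e2 := congrArg b h'
  have e3 := congrArg c h'
  interval_cases r <;>
  · simp [fundUnit, piElt, pow_succ] at e1 e2 e3
    omega

lemma isUnit_of_dvd_intCast_of_isCoprime {z : CbrtThree} {m n : ℤ} (h : IsCoprime m n)
    (hm : z ∣ (m : CbrtThree)) (hn : z ∣ (n : CbrtThree)) : IsUnit z := by
  have := h.map (Int.castRingHom CbrtThree)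
  exact this.isUnit_of_dvd' hm hn

/-- The generator `λ`. -/
def gen : CbrtThree := ⟨0, 1, 0⟩

lemma gen_pow_three : gen ^ 3 = 3 := by
  have : (3 : CbrtThree) = ((3 : ℤ) : CbrtThree) := by norm_cast
  rw [this, intCast_eq]
  ext <;> simp [gen, pow_succ]

lemma mk_eq (p q r : ℤ) : (⟨p, q, r⟩ : CbrtThree) = p + q * gen + r * gen ^ 2 := by
  ext <;> simp [gen, pow_succ]

lemma prime_piElt : Prime piElt := by
  refine Irreducible.prime ⟨?_, fun p q h => ?_⟩
  · rw [isUnit_iff, norm_piElt]; decide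
  · have h431 : Prime (431 : ℤ) := by norm_num
    simp only [isUnit_iff]
    refine h431.irreducible.isUnit_or_isUnit ?_
    rw [← norm_piElt, h, norm_mul]

section

variable {x y : ℤ}

lemma not_prime_dvd_of_isCoprime (hxy : IsCoprime x y) {z : CbrtThree} (hz : Prime z)
    (h1 : z ∣ (x : CbrtThree) + y * gen ^ 2) (h2 : z ∣ (y : CbrtThree)) : False :=
  hz.not_isUnit (isUnit_of_dvd_intCast_of_isCoprime hxy
    ((dvd_add_left (h2.mul_right _)).1 h1) h2)

lemma isCoprime_adj (hxy : IsCoprime x y) (hx : ¬ 3 ∣ x) :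
    IsCoprime (⟨x, 0, y⟩ : CbrtThree) (adj ⟨x, 0, y⟩) := by
  have e1 : (⟨x, 0, y⟩ : CbrtThree) = x + y * gen ^ 2 := by rw [mk_eq]; simp
  have e2 : adj (⟨x, 0, y⟩ : CbrtThree) = x ^ 2 + 3 * y ^ 2 * gen - x * y * gen ^ 2 := by
    rw [adj, mk_eq]; push_cast; ring
  have h3 : IsCoprime x 3 :=
    ((Int.prime_three.coprime_iff_not_dvd).2 hx).symm
  rw [e2, e1]
  refine isCoprime_of_prime_dvd ?_ fun z hz h1 h2 => ?_
  · rintro ⟨h0, -⟩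
    rw [← e1] at h0
    have h0' : x = 0 := congrArg CbrtThree.a h0
    exact hx (by simp [h0'])
  have hgen : ¬ z ∣ gen := fun h => by
    have hx' : z ∣ (x : CbrtThree) := (dvd_add_left ((h.pow two_ne_zero).mul_left _)).1 h1
    refine hz.not_isUnit (isUnit_of_dvd_intCast_of_isCoprime h3 hx' ?_)
    push_cast
    rw [← gen_pow_three]
    exact h.pow three_ne_zero
  have hy : ¬ z ∣ (y : CbrtThree) := not_prime_dvd_of_isCoprime hxy hz h1
  have hx' : ¬ z ∣ (x : CbrtThree) := fun h => by
    rcases hz.dvd_or_dvd ((dvd_add_right h).1 h1) with h | h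
    · exact hy h
    · exact hgen (hz.dvd_of_dvd_pow h)
  have h4 : z ∣ gen ^ 3 * x * y * gen ^ 2 := by
    have : gen ^ 3 * x * y * gen ^ 2 = (x + y * gen ^ 2) ^ 2
        - (x ^ 2 + 3 * y ^ 2 * gen - x * y * gen ^ 2) := by
      linear_combination (x * y * gen ^ 2 - y ^ 2 * gen : CbrtThree) * gen_pow_three
    rw [this]
    exact (h1.pow two_ne_zero).sub h2
  rcases hz.dvd_or_dvd h4 with h4 | h4
  · rcases hz.dvd_or_dvd h4 with h4 | h4
    · rcases hz.dvd_or_dvd h4 with h4 | h4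
      · exact hgen (hz.dvd_of_dvd_pow h4)
      · exact hx' h4
    · exact hy h4
  · exact hgen (hz.dvd_of_dvd_pow h4)

lemma piElt_eq : piElt = 8 - 3 * gen := by
  rw [piElt, mk_eq]; push_cast; ring

lemma adj_piElt_eq : adj piElt = 64 + 24 * gen + 9 * gen ^ 2 := by
  rw [adj, piElt, mk_eq]; norm_num

lemma piElt_mul_adj : piElt * adj piElt = 431 := by
  rw [mul_adj, norm_piElt]; norm_num

lemma isCoprime_piElt_adj : IsCoprime piElt (adj piElt) := by
  refine isCoprime_of_prime_dvd (fun h => prime_piElt.ne_zero h.1) fun z hz h1 h2 => ?_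
  have h3 : z ∣ ((431 : ℤ) : CbrtThree) := by
    push_cast
    rw [← piElt_mul_adj]
    exact h1.mul_right _
  refine hz.not_isUnit (isUnit_of_dvd_intCast_of_isCoprime
    (by norm_num : IsCoprime (431 : ℤ) 192) h3 ?_)
  have : ((192 : ℤ) : CbrtThree) = piElt * (3 * gen + 16) + adj piElt := by
    rw [adj_piElt_eq, piElt_eq]; push_cast; ring
  rw [this]
  exact (h1.mul_right _).add h2

lemma piElt_dvd (hd : 431 ∣ x + 55 * y) : piElt ∣ ⟨x, 0, y⟩ := by
  obtain ⟨k, hk⟩ := hd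
  have hx : x = 431 * k - 55 * y := by linarith
  refine ⟨adj piElt * k + y * ⟨-8, -3, -1⟩, ?_⟩
  rw [mul_add, ← mul_assoc, piElt_mul_adj, hx, mk_eq, mk_eq, piElt_eq]
  push_cast
  linear_combination (-3 * y : CbrtThree) * gen_pow_three

lemma isCoprime_adj_piElt (hxy : IsCoprime x y) (hd : 431 ∣ x + 55 * y) :
    IsCoprime (⟨x, 0, y⟩ : CbrtThree) (adj piElt) := by
  obtain ⟨k, hk⟩ := hd
  have hx : x = 431 * k - 55 * y := by linarith
  have e1 : (⟨x, 0, y⟩ : CbrtThree) = x + y * gen ^ 2 := by rw [mk_eq]; simp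
  rw [e1]
  refine isCoprime_of_prime_dvd ?_ fun z hz h1 h2 => ?_
  · rintro ⟨-, h0⟩
    simpa [adj, piElt] using congrArg CbrtThree.a h0
  have h3 : z ∣ ((431 : ℤ) : CbrtThree) := by
    push_cast
    rw [← piElt_mul_adj]
    exact h2.mul_left _
  have h4 : z ∣ (y : CbrtThree) * (gen ^ 2 - 55) := by
    have : (y : CbrtThree) * (gen ^ 2 - 55) = x + y * gen ^ 2 - (431 : ℤ) * k := by
      rw [hx]; push_cast; ring
    rw [this]
    exact h1.sub (h3.mul_right _)
  rcases hz.dvd_or_dvd h4 with h4 | h4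
  · exact not_prime_dvd_of_isCoprime hxy hz h1 h4
  refine hz.not_isUnit (isUnit_of_dvd_intCast_of_isCoprime
    (by norm_num : IsCoprime (431 : ℤ) 280801) h3 ?_)
  have : ((280801 : ℤ) : CbrtThree) =
      (gen ^ 2 - 55) * (576 + 9 * (24 * gen - 559)) - adj piElt * (24 * gen - 559) := by
    rw [adj_piElt_eq]; push_cast; ring
  rw [this]
  exact (h4.mul_right _).sub (h2.mul_right _)

end

lemma intCast_dvd_add_of_norm {x y w : ℤ} (h : x ^ 3 + 9 * y ^ 3 = 431 ^ 2 * w ^ 9) :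
    431 ∣ x + 55 * y := by
  have : Fact (Nat.Prime 431) := ⟨by norm_num⟩
  have h1 := congrArg (Int.cast : ℤ → ZMod 431) h
  have h431 : (431 : ZMod 431) = 0 := by exact_mod_cast ZMod.natCast_self 431
  simp only [Int.cast_add, Int.cast_mul, Int.cast_pow, Int.cast_ofNat, h431] at h1
  have h2 : (x : ZMod 431) ^ 3 = (-55 * y) ^ 3 := by
    linear_combination h1 + 386 * (y : ZMod 431) ^ 3 * h431
  have h3 : (x : ZMod 431) = -55 * y := ZMod.cube_injective (by norm_num) h2
  refine (ZMod.intCast_zmod_eq_zero_iff_dvd _ 431).1 ?_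
  push_cast
  rw [h3]
  ring

theorem cube_add_nine_mul_cube_ne {x y : ℤ} (hxy : IsCoprime x y) (hx : ¬ 3 ∣ x) (hy : 3 ∣ y)
    (w : ℤ) : x ^ 3 + 9 * y ^ 3 ≠ 431 ^ 2 * w ^ 9 := by
  intro h
  have hd := intCast_dvd_add_of_norm h
  set α : CbrtThree := ⟨x, 0, y⟩ with hα
  have hN : norm α = 431 ^ 2 * w ^ 9 := by rw [← h]; simp [norm, hα]
  have hαπ := piElt_dvd hd
  have hc1 := isCoprime_adj hxy hx
  have hc2 := isCoprime_adj_piElt hxy hd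
  have hc3 := isCoprime_piElt_adj
  have hc4 : IsCoprime piElt (adj α) := hc1.of_isCoprime_of_dvd_left hαπ
  have hcop : IsCoprime (α * piElt ^ 7) (adj α * adj piElt ^ 7) :=
    (hc1.mul_right hc2.pow_right).mul_left (hc4.mul_right hc3.pow_right).pow_left
  have hprod : α * piElt ^ 7 * (adj α * adj piElt ^ 7) = (431 * w : CbrtThree) ^ 9 := by
    calc _ = (α * adj α) * (piElt * adj piElt) ^ 7 := by ring
      _ = _ := by rw [mul_adj, hN, piElt_mul_adj]; push_cast; ring
  obtain ⟨d, u, hu⟩ := exists_associated_pow_of_mul_eq_pow' hcop hprod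
  have hdvd : piElt ∣ d := by
    refine prime_piElt.dvd_of_dvd_pow (n := 9) ((u.isUnit.dvd_mul_right).1 ?_)
    rw [hu]
    exact hαπ.mul_right _
  obtain ⟨v, rfl⟩ := hdvd
  refine ne_unit_mul_piElt_sq_mul_pow_nine hx hy u.isUnit (v := v)
    (mul_right_cancel₀ (pow_ne_zero 7 prime_piElt.ne_zero) ?_)
  rw [← hα, ← hu]
  ring

end CbrtThree

lemma Int.dvd_and_dvd_of_dvd_sq_add_mul_add_sq {p : ℕ} (hp : p.Prime) (hp3 : p % 3 = 2) {s t : ℤ}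
    (h : (p : ℤ) ∣ s ^ 2 + s * t + t ^ 2) : (p : ℤ) ∣ s ∧ (p : ℤ) ∣ t := by
  have := Fact.mk hp
  rw [← ZMod.intCast_zmod_eq_zero_iff_dvd] at h
  push_cast at h
  have hst : (s : ZMod p) = t := ZMod.cube_injective hp3 (by
    simp only
    linear_combination (s - t : ZMod p) * h)
  have h3 : ((3 : ℕ) : ZMod p) ≠ 0 := fun h0 => by
    rw [ZMod.natCast_eq_zero_iff, Nat.prime_dvd_prime_iff_eq hp Nat.prime_three] at h0
    omega
  have ht : (t : ZMod p) = 0 := by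
    rw [hst] at h
    have : ((3 : ℕ) : ZMod p) * (t : ZMod p) ^ 2 = 0 := by push_cast; linear_combination h
    exact pow_eq_zero_iff two_ne_zero |>.1 ((mul_eq_zero.1 this).resolve_left h3)
  exact ⟨(ZMod.intCast_zmod_eq_zero_iff_dvd _ _).1 (hst.trans ht),
    (ZMod.intCast_zmod_eq_zero_iff_dvd _ _).1 ht⟩

section

variable {x y : ℤ}

lemma isCoprime_quadratic (hxy : IsCoprime x y) (b c : ℤ) {p : ℕ} (hp : p.Prime) (hp3 : p % 3 = 2)
    (hbc : 9 * b ^ 3 + c ^ 3 = p) (hc : ¬ (p : ℤ) ∣ c) :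
    IsCoprime (x ^ 3 + 9 * y ^ 3) ((b * x) ^ 2 + (b * x) * (c * y) + (c * y) ^ 2) := by
  have hpZ : Prime (p : ℤ) := Nat.prime_iff_prime_int.1 hp
  have main : ∀ z : ℤ, Prime z → z ∣ x ^ 3 + 9 * y ^ 3 → ¬ z ∣ y := fun z hz h1 h2 => by
    have h3 : z ∣ x := hz.dvd_of_dvd_pow (n := 3)
      ((dvd_add_left ((h2.pow three_ne_zero).mul_left 9)).1 h1)
    exact hz.not_isUnit (hxy.isUnit_of_dvd' h3 h2)
  have key : (p : ℤ) * y ^ 3 = (x ^ 3 + 9 * y ^ 3) * b ^ 3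
      - ((b * x) ^ 2 + (b * x) * (c * y) + (c * y) ^ 2) * (b * x - c * y) := by
    rw [← hbc]; ring
  refine isCoprime_of_prime_dvd ?_ fun z hz h1 h2 => ?_
  · rintro ⟨h0, h0'⟩
    rw [h0, h0', zero_mul, zero_mul, sub_zero] at key
    have hy : y = 0 := by simpa [hp.ne_zero] using key
    exact main 2 Int.prime_two (h0 ▸ dvd_zero _) (hy ▸ dvd_zero _)
  have h3 : z ∣ p * y ^ 3 := by
    rw [key]
    exact (h1.mul_right _).sub (h2.mul_right _)
  have hzy := main z hz h1
  rcases hz.dvd_or_dvd h3 with h3 | h3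
  · have hpz : (p : ℤ) ∣ z := (hz.associated_of_dvd hpZ h3).symm.dvd
    have h4 := (Int.dvd_and_dvd_of_dvd_sq_add_mul_add_sq hp hp3 (hpz.trans h2)).2
    exact hzy (h3.trans ((hpZ.dvd_or_dvd h4).resolve_left hc))
  · exact hzy (hz.dvd_of_dvd_pow h3)

lemma isCoprime_prime_quadratic (hxy : IsCoprime x y) (b c : ℤ) {p : ℕ} (hp : p.Prime)
    (hp3 : p % 3 = 2) (hb : ¬ (p : ℤ) ∣ b) (hc : ¬ (p : ℤ) ∣ c) :
    IsCoprime (p : ℤ) ((b * x) ^ 2 + (b * x) * (c * y) + (c * y) ^ 2) := by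
  have hpZ : Prime (p : ℤ) := Nat.prime_iff_prime_int.1 hp
  rw [hpZ.coprime_iff_not_dvd]
  intro h
  obtain ⟨h1, h2⟩ := Int.dvd_and_dvd_of_dvd_sq_add_mul_add_sq hp hp3 h
  exact hpZ.not_isUnit (hxy.isUnit_of_dvd' ((hpZ.dvd_or_dvd h1).resolve_left hb)
    ((hpZ.dvd_or_dvd h2).resolve_left hc))

/-- The form of degree `9` on the left-hand side of the equation. -/
def nonicForm {K : Type*} [CommRing K] (x y : K) : K :=
  (x ^ 3 + 9 * y ^ 3) * ((x ^ 2 + 2 * x * y + 4 * y ^ 2) *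
    (4 * x ^ 2 - 10 * x * y + 25 * y ^ 2) * (4 * x ^ 2 - 2 * x * y + y ^ 2))

lemma not_three_dvd_and_three_dvd {z : ℤ} (hxy : IsCoprime x y)
    (h : nonicForm x y = 431 ^ 2 * z ^ 9) : ¬ 3 ∣ x ∧ 3 ∣ y := by
  have h9 : ∀ z : ZMod 27, 431 ^ 2 * z ^ 9 = 0 ∨ 431 ^ 2 * z ^ 9 = 1 ∨ 431 ^ 2 * z ^ 9 = -1 := by
    decide +kernel
  have h27 : ∀ x y : ZMod 27, nonicForm x y = 0 ∨ nonicForm x y = 1 ∨ nonicForm x y = -1 →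
      9 * y = 0 := by
    unfold nonicForm; decide +kernel
  have hc : (nonicForm x y : ZMod 27) = 431 ^ 2 * z ^ 9 := by
    have := congrArg (Int.cast : ℤ → ZMod 27) h
    norm_num [nonicForm] at this ⊢
    exact this
  have hy : ((9 * y : ℤ) : ZMod 27) = 0 := by
    push_cast
    refine h27 x y ?_
    rw [hc]
    exact h9 z
  rw [ZMod.intCast_zmod_eq_zero_iff_dvd] at hy
  have hy' : 3 ∣ y := by omega
  exact ⟨fun hx => Int.prime_three.not_isUnit (hxy.isUnit_of_dvd' hx hy'), hy'⟩

lemma nonicForm_ne (hxy : IsCoprime x y) (z : ℤ) : nonicForm x y ≠ 431 ^ 2 * z ^ 9 := by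
  intro h
  obtain ⟨hx3, hy3⟩ := not_three_dvd_and_three_dvd hxy h
  set Q : ℤ := ((1 * x) ^ 2 + (1 * x) * (2 * y) + (2 * y) ^ 2) *
    (((-2) * x) ^ 2 + ((-2) * x) * (5 * y) + (5 * y) ^ 2) *
    ((2 * x) ^ 2 + (2 * x) * ((-1) * y) + ((-1) * y) ^ 2) with hQ
  have hF : nonicForm x y = (x ^ 3 + 9 * y ^ 3) * Q := by rw [nonicForm, hQ]; ring
  have hcop : IsCoprime (x ^ 3 + 9 * y ^ 3) Q :=
    ((isCoprime_quadratic hxy 1 2 (p := 17) (by norm_num) rfl (by norm_num) (by norm_num)).mul_right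
      (isCoprime_quadratic hxy (-2) 5 (p := 53) (by norm_num) rfl (by norm_num)
        (by norm_num))).mul_right
      (isCoprime_quadratic hxy 2 (-1) (p := 71) (by norm_num) rfl (by norm_num) (by norm_num))
  have h431 : Nat.Prime 431 := by norm_num
  have hcop' : IsCoprime (((431 : ℕ) : ℤ) ^ 2) Q :=
    (((isCoprime_prime_quadratic hxy 1 2 h431 rfl (by norm_num) (by norm_num)).mul_right
      (isCoprime_prime_quadratic hxy (-2) 5 h431 rfl (by norm_num) (by norm_num))).mul_right
      (isCoprime_prime_quadratic hxy 2 (-1) h431 rfl (by norm_num) (by norm_num))).pow_left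
  rw [hF] at h
  obtain ⟨m, hm⟩ : ((431 : ℕ) : ℤ) ^ 2 ∣ x ^ 3 + 9 * y ^ 3 :=
    hcop'.dvd_of_dvd_mul_right ⟨z ^ 9, by rw [h]; norm_num⟩
  have hmQ : m * Q = z ^ 9 := by
    rw [hm] at h
    push_cast at h
    linarith
  rw [hm] at hcop
  obtain ⟨⟨w, hw⟩, -⟩ := Int.eq_pow_of_mul_eq_pow_odd hcop.of_mul_left_right (by decide) hmQ
  exact CbrtThree.cube_add_nine_mul_cube_ne hxy hx3 hy3 w (by rw [hm, hw]; norm_num)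

end

lemma nonicForm_eq_rat {X Y Z : ℚ} (h : nonicForm X Y = 431 ^ 2 * Z ^ 9) :
    X = 0 ∧ Y = 0 ∧ Z = 0 := by
  by_cases hXY : X = 0 ∧ Y = 0
  · obtain ⟨rfl, rfl⟩ := hXY
    norm_num [nonicForm] at h
    exact ⟨rfl, rfl, h⟩
  exfalso
  obtain ⟨x, y, r, hr, hxy, rfl, rfl⟩ : ∃ (x y : ℤ) (r : ℚ), r ≠ 0 ∧ IsCoprime x y ∧
      X = r * x ∧ Y = r * y := by
    have hgcd : 0 < Int.gcd (X.num * Y.den) (Y.num * X.den) := by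
      rw [Int.gcd_pos_iff]
      by_contra! hcon
      exact hXY (by simpa using hcon)
    obtain ⟨x, y, hco, hx, hy⟩ := Int.exists_gcd_one hgcd
    have hXd : (X.den : ℚ) ≠ 0 := by exact_mod_cast X.den_ne_zero
    have hYd : (Y.den : ℚ) ≠ 0 := by exact_mod_cast Y.den_ne_zero
    refine ⟨x, y, Int.gcd (X.num * Y.den) (Y.num * X.den) / (X.den * Y.den), ?_,
      Int.isCoprime_iff_gcd_eq_one.2 hco, ?_, ?_⟩
    · have : (Int.gcd (X.num * Y.den) (Y.num * X.den) : ℚ) ≠ 0 := by exact_mod_cast hgcd.ne'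
      positivity
    · have hx' : (X.num * Y.den : ℚ) = x * Int.gcd (X.num * Y.den) (Y.num * X.den) := by
        exact_mod_cast hx
      nth_rewrite 1 [← X.num_div_den]
      field_simp
      linarith
    · have hy' : (Y.num * X.den : ℚ) = y * Int.gcd (X.num * Y.den) (Y.num * X.den) := by
        exact_mod_cast hy
      nth_rewrite 1 [← Y.num_div_den]
      field_simp
      linarith
  have h1 : (431 * (Z / r)) ^ 9 = ((431 ^ 7 * nonicForm x y : ℤ) : ℚ) := by
    have : (nonicForm (x : ℚ) y) * r ^ 9 = 431 ^ 2 * Z ^ 9 := by rw [← h]; unfold nonicForm; ring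
    have hcast : ((nonicForm x y : ℤ) : ℚ) = nonicForm (x : ℚ) y := by simp [nonicForm]
    push_cast
    rw [hcast]
    field_simp
    linarith
  have h_integral : IsIntegral ℤ ((431 * (Z / r)) ^ 9) := by
    rw [h1]
    exact isIntegral_algebraMap (R := ℤ)
  obtain ⟨m, hm⟩ := IsIntegrallyClosed.exists_algebraMap_eq_of_isIntegral_pow
    (by norm_num) h_integral
  rw [← hm] at h1
  simp only [algebraMap_int_eq, eq_intCast] at h1
  have h2 : m ^ 9 = 431 ^ 7 * nonicForm x y := by exact_mod_cast h1
  obtain ⟨z, rfl⟩ : 431 ∣ m := (by norm_num : Prime (431 : ℤ)).dvd_of_dvd_pow (n := 9)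
    (h2 ▸ (dvd_pow_self 431 (by norm_num)).mul_right _)
  exact nonicForm_ne hxy z (by linarith)

lemma PadicInt.exists_root_of_dvd {p : ℕ} [Fact p.Prime] (F : Polynomial ℤ) (a : ℤ)
    (h1 : (p : ℤ) ∣ F.eval a) (h2 : ¬ (p : ℤ) ∣ F.derivative.eval a) :
    ∃ z : ℤ_[p], Polynomial.aeval z F = 0 := by
  have haeval : ∀ G : Polynomial ℤ, Polynomial.aeval (a : ℤ_[p]) G = ((G.eval a : ℤ) : ℤ_[p]) :=
    fun G => by simpa using Polynomial.aeval_algebraMap_apply_eq_algebraMap_eval (A := ℤ_[p]) a G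
  obtain ⟨z, hz, -⟩ := hensels_lemma (p := p) (F := F) (a := (a : ℤ_[p])) (by
    have hd : ‖((F.derivative.eval a : ℤ) : ℤ_[p])‖ = 1 :=
      le_antisymm (PadicInt.norm_le_one _)
        (not_lt.1 fun h => h2 ((PadicInt.norm_int_lt_one_iff_dvd _).1 h))
    rw [haeval, haeval, hd, one_pow]
    exact (PadicInt.norm_int_lt_one_iff_dvd _).2 h1)
  exact ⟨z, hz⟩

lemma exists_padic_cube_eq_neg_nine {p : ℕ} [hp : Fact p.Prime] (hp3 : p % 3 = 2) :
    ∃ X : ℚ_[p], X ^ 3 + 9 = 0 := by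
  obtain ⟨t, ht⟩ := Finite.injective_iff_surjective.1 (ZMod.cube_injective hp3) (-9)
  obtain ⟨a, rfl⟩ := ZMod.intCast_surjective t
  have hpZ : Prime (p : ℤ) := Nat.prime_iff_prime_int.1 hp.out
  have hp3' : ¬ (p : ℤ) ∣ 3 := fun h => by
    have h' : p ∣ 3 := by exact_mod_cast h
    rw [Nat.prime_dvd_prime_iff_eq hp.out Nat.prime_three] at h'
    omega
  have hdvd : (p : ℤ) ∣ a ^ 3 + 9 := by
    rw [← ZMod.intCast_zmod_eq_zero_iff_dvd]
    push_cast
    simp only at ht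
    rw [ht]
    ring
  obtain ⟨z, hz⟩ := PadicInt.exists_root_of_dvd (p := p) (Polynomial.X ^ 3 + 9) a
    (by simpa using hdvd) (by
      intro h
      replace h : (p : ℤ) ∣ 3 * a ^ 2 := by simpa using h
      have ha := hpZ.dvd_of_dvd_pow ((hpZ.dvd_or_dvd h).resolve_left hp3')
      have h9 : (p : ℤ) ∣ 3 ^ 2 := (dvd_add_right (ha.pow three_ne_zero)).1 hdvd
      exact hp3' (hpZ.dvd_of_dvd_pow h9))
  refine ⟨z, ?_⟩
  have hz' : z ^ 3 + 9 = 0 := by simpa [map_ofNat] using hz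
  exact_mod_cast congrArg (Subtype.val) hz'

lemma exists_padic_sq_add_self_add_one {p : ℕ} [hp : Fact p.Prime] (hp3 : p % 3 = 1) :
    ∃ X : ℚ_[p], X ^ 2 + X + 1 = 0 := by
  have := Fact.mk Nat.prime_three
  obtain ⟨u, hu⟩ := exists_prime_orderOf_dvd_card (G := (ZMod p)ˣ) 3 (by
    rw [ZMod.card_units]; omega)
  have hu3 : (u : ZMod p) ^ 3 = 1 := by
    have := pow_orderOf_eq_one u
    rw [hu] at this
    rw [← Units.val_pow_eq_pow_val, this, Units.val_one]
  have hu1 : (u : ZMod p) - 1 ≠ 0 := fun h => by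
    have : u = 1 := Units.ext (sub_eq_zero.1 h)
    rw [this, orderOf_one] at hu
    omega
  obtain ⟨a, ha⟩ := ZMod.intCast_surjective (u : ZMod p)
  have hdvd : (p : ℤ) ∣ a ^ 2 + a + 1 := by
    rw [← ZMod.intCast_zmod_eq_zero_iff_dvd]
    push_cast
    rw [ha]
    exact (mul_eq_zero.1 (by linear_combination hu3 :
      ((u : ZMod p) - 1) * ((u : ZMod p) ^ 2 + u + 1) = 0)).resolve_left hu1
  obtain ⟨z, hz⟩ := PadicInt.exists_root_of_dvd (p := p) (Polynomial.X ^ 2 + Polynomial.X + 1) a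
    (by simpa using hdvd) (by
      intro h
      replace h : (p : ℤ) ∣ 2 * a + 1 := by simpa using h
      have h3 : (p : ℤ) ∣ (3 : ℕ) := by
        have : ((3 : ℕ) : ℤ) = (a ^ 2 + a + 1) * 4 - (2 * a + 1) * (2 * a + 1) := by
          push_cast; ring
        rw [this]
        exact (hdvd.mul_right _).sub (h.mul_right _)
      rw [Int.natCast_dvd_natCast, Nat.prime_dvd_prime_iff_eq hp.out Nat.prime_three] at h3
      omega)
  refine ⟨z, ?_⟩
  have hz' : z ^ 2 + z + 1 = 0 := by simpa using hz
  exact_mod_cast congrArg (Subtype.val) hz'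

lemma exists_three_adic [Fact (Nat.Prime 3)] :
    ∃ Z : ℚ_[3], nonicForm (1 : ℚ_[3]) (-3) = 431 ^ 2 * Z ^ 9 := by
  set F : Polynomial ℤ := Polynomial.C 185761 * Polynomial.X ^ 9 +
    Polynomial.C 36917342 with hF
  have haeval : ∀ G : Polynomial ℤ,
      Polynomial.aeval ((10 : ℤ) : ℤ_[3]) G = ((G.eval 10 : ℤ) : ℤ_[3]) :=
    fun G => by simpa using Polynomial.aeval_algebraMap_apply_eq_algebraMap_eval (A := ℤ_[3]) 10 G
  obtain ⟨z, hz, -⟩ := hensels_lemma (p := 3) (F := F) (a := ((10 : ℤ) : ℤ_[3])) (by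
    rw [haeval, haeval]
    have h1 : ‖((F.eval 10 : ℤ) : ℤ_[3])‖ ≤ ((3 : ℕ) : ℝ) ^ (-((5 : ℕ) : ℤ)) := by
      rw [PadicInt.norm_int_le_pow_iff_dvd]
      simp [hF]
    have h2 : F.derivative.eval 10 = (3 : ℕ) ^ 2 * (185761 * 10 ^ 8) := by
      simp [hF]
    have h3 : ‖((185761 * 10 ^ 8 : ℤ) : ℤ_[3])‖ = 1 :=
      le_antisymm (PadicInt.norm_le_one _) (not_lt.1 fun h => by
        rw [PadicInt.norm_int_lt_one_iff_dvd] at h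
        norm_num at h)
    rw [h2, Int.cast_mul, norm_mul, h3, mul_one, Int.cast_pow, Int.cast_natCast, norm_pow,
      PadicInt.norm_p]
    refine h1.trans_lt ?_
    norm_num)
  refine ⟨z, ?_⟩
  have hz' : 185761 * z ^ 9 + 36917342 = 0 := by simpa [hF, map_ofNat] using hz
  have h : 185761 * (z : ℚ_[3]) ^ 9 + 36917342 = 0 := by exact_mod_cast congrArg Subtype.val hz'
  rw [nonicForm]
  linear_combination -h

lemma exists_padic (p : ℕ) [hp : Fact p.Prime] :
    ∃ X Y Z : ℚ_[p], (X, Y, Z) ≠ (0, 0, 0) ∧ nonicForm X Y = 431 ^ 2 * Z ^ 9 := by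
  obtain h | h | h : p % 3 = 0 ∨ p % 3 = 1 ∨ p % 3 = 2 := by omega
  · obtain rfl : 3 = p := (Nat.prime_dvd_prime_iff_eq Nat.prime_three hp.out).1
      (Nat.dvd_of_mod_eq_zero h)
    obtain ⟨Z, hZ⟩ := exists_three_adic
    exact ⟨1, -3, Z, by simp, hZ⟩
  · obtain ⟨X, hX⟩ := exists_padic_sq_add_self_add_one h
    refine ⟨2 * X, 1, 0, by simp, ?_⟩
    rw [nonicForm]
    linear_combination (((2 * X) ^ 3 + 9) * 4 * (4 * (2 * X) ^ 2 - 10 * (2 * X) + 25) *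
      (4 * (2 * X) ^ 2 - 2 * (2 * X) + 1)) * hX
  · obtain ⟨X, hX⟩ := exists_padic_cube_eq_neg_nine h
    refine ⟨X, 1, 0, by simp, ?_⟩
    rw [nonicForm, one_pow, mul_one, hX]
    ring

lemma exists_real : ∃ X Y Z : ℝ, (X, Y, Z) ≠ (0, 0, 0) ∧ nonicForm X Y = 431 ^ 2 * Z ^ 9 := by
  refine ⟨1, 0, (16 / 431 ^ 2) ^ ((1 : ℝ) / 9), by simp, ?_⟩
  rw [← Real.rpow_natCast ((16 / 431 ^ 2 : ℝ) ^ _), ← Real.rpow_mul (by norm_num)]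
  norm_num [nonicForm]

lemma eqnHolds_iff {K : Type} [CommRing K] {X Y Z : K} :
    EqnHolds 9 (431 ^ 2) 9 ![(1, 2), (-2, 5), (2, -1)] X Y Z ↔
      nonicForm X Y = 431 ^ 2 * Z ^ 9 := by
  simp only [EqnHolds, nonicForm, Fin.prod_univ_three, Matrix.cons_val]
  push_cast
  ring_nf

lemma violatesLGP_nonic : ViolatesLGP 9 (431 ^ 2) 9 ![(1, 2), (-2, 5), (2, -1)] := by
  simp only [ViolatesLGP, eqnHolds_iff]
  refine ⟨exists_real, fun l _ => exists_padic l, fun X Y Z h => ?_⟩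
  obtain ⟨rfl, rfl, rfl⟩ := nonicForm_eq_rat h
  rfl

lemma curvePoly_isHomogeneous (a L : ℤ) {m n : ℕ} (bc : Fin m → ℤ × ℤ) (hn : n = 3 + 2 * m) :
    (curvePoly a L n bc).IsHomogeneous n := by
  have hX : ∀ (i : Fin 3) (k : ℕ), (X i ^ k : MvPolynomial (Fin 3) ℂ).IsHomogeneous k :=
    fun i k => isHomogeneous_X_pow i k
  have hprod := IsHomogeneous.prod (Finset.univ : Finset (Fin m)) (fun j =>
    (C (((bc j).1 : ℂ)) ^ 2 * X 0 ^ 2 + C (((bc j).1 : ℂ)) * C (((bc j).2 : ℂ)) * X 0 * X 1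
        + C (((bc j).2 : ℂ)) ^ 2 * X 1 ^ 2 : MvPolynomial (Fin 3) ℂ)) (fun _ => 2) fun j _ => by
    simp only [mul_assoc, ← C_pow]
    exact (((hX 0 2).C_mul _).add ((((isHomogeneous_X ℂ 0).mul
      (isHomogeneous_X ℂ 1)).C_mul _).C_mul _)).add ((hX 1 2).C_mul _)
  have h := ((hX 0 3).add ((hX 1 3).C_mul (a : ℂ))).mul hprod
  have hn' : 3 + ∑ _j : Fin m, 2 = n := by simp [hn, mul_comm]
  rw [hn'] at h
  exact h.sub ((hX 2 n).C_mul _)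

lemma curvePoly_ne_zero (a : ℤ) {L : ℤ} (hL : L ≠ 0) {m : ℕ} (n : ℕ) (bc : Fin m → ℤ × ℤ) :
    curvePoly a L n bc ≠ 0 := by
  intro h
  have := congrArg (eval ![0, 0, 1]) h
  simp [curvePoly, hL] at this

section

variable {K : Type*} [Field K]

lemma singular_zero_of_mul {g h g₁ h₁ g₂ h₂ : K} (h0 : g * h = 0) (h1 : g₁ * h + g * h₁ = 0)
    (h2 : g₂ * h + g * h₂ = 0) :
    (g = 0 ∧ h = 0) ∨ (g₁ = 0 ∧ g₂ = 0) ∨ (h = 0 ∧ h₁ = 0 ∧ h₂ = 0) := by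
  by_cases hg : g = 0 <;> by_cases hh : h = 0 <;> simp_all

variable {x y b c : K}

lemma eq_zero_of_cubic_eq_zero_of_quadratic_eq_zero (hbc : 9 * b ^ 3 + c ^ 3 ≠ 0)
    (hf : x ^ 3 + 9 * y ^ 3 = 0) (hq : b ^ 2 * x ^ 2 + b * c * x * y + c ^ 2 * y ^ 2 = 0) :
    x = 0 ∧ y = 0 := by
  have h : (9 * b ^ 3 + c ^ 3) * y ^ 3 = 0 := by
    linear_combination b ^ 3 * hf - (b * x - c * y) * hq
  have hy : y = 0 := by simpa [hbc] using h
  subst hy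
  exact ⟨by simpa using hf, rfl⟩

lemma eq_zero_of_quadratics_eq_zero {b' c' : K} (hb : b ≠ 0) (hbc : (b * c') ^ 3 ≠ (b' * c) ^ 3)
    (hq : b ^ 2 * x ^ 2 + b * c * x * y + c ^ 2 * y ^ 2 = 0)
    (hq' : b' ^ 2 * x ^ 2 + b' * c' * x * y + c' ^ 2 * y ^ 2 = 0) : x = 0 ∧ y = 0 := by
  have h : ((b * c') ^ 3 - (b' * c) ^ 3) * y ^ 3 = 0 := by
    linear_combination b' ^ 3 * (b * x - c * y) * hq - b ^ 3 * (b' * x - c' * y) * hq'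
  have hy : y = 0 := by simpa [sub_ne_zero.2 hbc] using h
  subst hy
  exact ⟨by simpa [hb] using hq, rfl⟩

lemma eq_zero_of_quadratic_partials_eq_zero (hbc : 3 * b * c ≠ 0)
    (hx : 2 * b ^ 2 * x + b * c * y = 0) (hy : b * c * x + 2 * c ^ 2 * y = 0) :
    x = 0 ∧ y = 0 := by
  have hbc' : 3 * b ^ 2 * c ^ 2 ≠ 0 := by simp_all
  exact ⟨(mul_eq_zero.1 (by linear_combination 2 * c ^ 2 * hx - b * c * hy)).resolve_left hbc',
    (mul_eq_zero.1 (by linear_combination 2 * b ^ 2 * hy - b * c * hx)).resolve_left hbc'⟩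

end

lemma isNonsingular_nonic :
    IsNonsingular (curvePoly 9 (431 ^ 2) 9 ![(1, 2), (-2, 5), (2, -1)]) := by
  rintro v hv ⟨h, hd⟩
  have hcoe (r : ℂ) (i : Fin 3) : pderiv i (C r : MvPolynomial (Fin 3) ℂ) = 0 := pderiv_C
  have h2 : ∀ i, pderiv i (2 : MvPolynomial (Fin 3) ℂ) = 0 := hcoe 2
  have h5 : ∀ i, pderiv i (5 : MvPolynomial (Fin 3) ℂ) = 0 := hcoe 5
  have hx := hd 0
  have hy := hd 1
  have hz := hd 2
  simp [curvePoly, Fin.prod_univ_three, Derivation.leibniz, pderiv_X, h2, h5] at h hx hy hz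
  rw [hz] at h
  suffices hv' : v 0 = 0 ∧ v 1 = 0 by
    refine hv (funext fun i => ?_)
    fin_cases i
    exacts [hv'.1, hv'.2, hz]
  generalize v 0 = x at *
  generalize v 1 = y at *
  obtain ⟨hF, hQ⟩ | ⟨h1, h2⟩ | ⟨h0, h1, h2⟩ := singular_zero_of_mul
    (g := x ^ 3 + 9 * y ^ 3) (g₁ := 3 * x ^ 2) (g₂ := 27 * y ^ 2)
    (h := (x ^ 2 + 2 * x * y + 4 * y ^ 2) * ((4 * x ^ 2 - 10 * x * y + 25 * y ^ 2) *
      (4 * x ^ 2 - 2 * x * y + y ^ 2)))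
    (h₁ := (2 * x + 2 * y) * ((4 * x ^ 2 - 10 * x * y + 25 * y ^ 2) *
      (4 * x ^ 2 - 2 * x * y + y ^ 2)) + (x ^ 2 + 2 * x * y + 4 * y ^ 2) *
      ((8 * x - 10 * y) * (4 * x ^ 2 - 2 * x * y + y ^ 2) +
        (4 * x ^ 2 - 10 * x * y + 25 * y ^ 2) * (8 * x - 2 * y)))
    (h₂ := (2 * x + 8 * y) * ((4 * x ^ 2 - 10 * x * y + 25 * y ^ 2) *
      (4 * x ^ 2 - 2 * x * y + y ^ 2)) + (x ^ 2 + 2 * x * y + 4 * y ^ 2) *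
      ((50 * y - 10 * x) * (4 * x ^ 2 - 2 * x * y + y ^ 2) +
        (4 * x ^ 2 - 10 * x * y + 25 * y ^ 2) * (2 * y - 2 * x)))
    (by linear_combination h) (by linear_combination hx) (by linear_combination hy)
  · rcases mul_eq_zero.1 hQ with hQ | hQ
    · exact eq_zero_of_cubic_eq_zero_of_quadratic_eq_zero (b := 1) (c := 2) (by norm_num) hF
        (by linear_combination hQ)
    rcases mul_eq_zero.1 hQ with hQ | hQ
    · exact eq_zero_of_cubic_eq_zero_of_quadratic_eq_zero (b := -2) (c := 5) (by norm_num) hF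
        (by linear_combination hQ)
    · exact eq_zero_of_cubic_eq_zero_of_quadratic_eq_zero (b := 2) (c := -1) (by norm_num) hF
        (by linear_combination hQ)
  · simpa using And.intro h1 h2
  obtain ⟨hF, hQ⟩ | ⟨h1, h2⟩ | ⟨h0, h1, h2⟩ := singular_zero_of_mul h0 h1 h2
  · rcases mul_eq_zero.1 hQ with hQ | hQ
    · exact eq_zero_of_quadratics_eq_zero (b := 1) (c := 2) (b' := -2) (c' := 5) (by norm_num)
        (by norm_num) (by linear_combination hF) (by linear_combination hQ)
    · exact eq_zero_of_quadratics_eq_zero (b := 1) (c := 2) (b' := 2) (c' := -1) (by norm_num)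
        (by norm_num) (by linear_combination hF) (by linear_combination hQ)
  · exact eq_zero_of_quadratic_partials_eq_zero (b := 1) (c := 2) (by norm_num)
      (by linear_combination h1) (by linear_combination h2)
  obtain ⟨hF, hQ⟩ | ⟨h1, h2⟩ | ⟨h0, h1, h2⟩ := singular_zero_of_mul h0 h1 h2
  · exact eq_zero_of_quadratics_eq_zero (b := -2) (c := 5) (b' := 2) (c' := -1) (by norm_num)
      (by norm_num) (by linear_combination hF) (by linear_combination hQ)
  · exact eq_zero_of_quadratic_partials_eq_zero (b := -2) (c := 5) (by norm_num)
      (by linear_combination h1) (by linear_combination h2)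
  · exact eq_zero_of_quadratic_partials_eq_zero (b := 2) (c := -1) (by norm_num)
      (by linear_combination h1) (by linear_combination h2)

/-- The degree-9 example:
`(X³+9Y³)(X²+2XY+4Y²)(4X²-10XY+25Y²)(4X²-2XY+Y²) = 431² Z⁹` defines a non-singular
plane projective curve of degree 9 which violates the local-global principle. -/
theorem degree_nine_example :
    ViolatesLGP 9 (431 ^ 2) 9 ![(1, 2), (-2, 5), (2, -1)] ∧
    (curvePoly 9 (431 ^ 2) 9 ![(1, 2), (-2, 5), (2, -1)]).totalDegree = 9 ∧
    IsNonsingular (curvePoly 9 (431 ^ 2) 9 ![(1, 2), (-2, 5), (2, -1)]) := by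
  exact ⟨violatesLGP_nonic, (curvePoly_isHomogeneous _ _ _ rfl).totalDegree
    (curvePoly_ne_zero _ (by norm_num) _ _), isNonsingular_nonic⟩
end
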